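/- Let m ≥ 1, n ≥ 1, and let λ = (λ₀,…,λ_{m−1}) be generic. Consider representation data of constant dimension vector α₀ = α₁ = ⋯ = α_{m−1} = n (so all X_i, Y_i are n × n matrices); the set of GL-orbits of such data is the generalized n-th Calogero–Moser space C^τ_{n,m}. Then the group generated by all Ψ_{k,μ}, all Φ_{k,ν} (k ≥ 1, μ, ν ∈ ℂ) and all base changes acts transitively on this set of representation data: any two tuples satisfying (qv1)–(qv2) are carried into each other by a finite composition of these transformations. -/

import Mathlib

open Matrix

namespace CM

noncomputable section

variable {α : ℕ → ℕ}

/-- Reindex a square complex matrix along an equality of sizes. -/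
def recast {a b : ℕ} (h : a = b) (M : Matrix (Fin a) (Fin a) ℂ) :
    Matrix (Fin b) (Fin b) ℂ :=
  M.submatrix (Fin.cast h.symm) (Fin.cast h.symm)

/-- `yprod Y k = Y (k-1) * ⋯ * Y 1 * Y 0`. -/
def yprod (Y : ∀ i : ℕ, Matrix (Fin (α (i + 1))) (Fin (α i)) ℂ) :
    (k : ℕ) → Matrix (Fin (α k)) (Fin (α 0)) ℂ
  | 0 => 1
  | k + 1 => Y k * yprod Y k

/-- `xprod X k = X 0 * X 1 * ⋯ * X (k-1)`. -/
def xprod (X : ∀ i : ℕ, Matrix (Fin (α i)) (Fin (α (i + 1))) ℂ) :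
    (k : ℕ) → Matrix (Fin (α 0)) (Fin (α k)) ℂ
  | 0 => 1
  | k + 1 => xprod X k * X k

/-- `ysegFrom Y i k = Y (i+k-1) * ⋯ * Y (i+1) * Y i`. -/
def ysegFrom (Y : ∀ i : ℕ, Matrix (Fin (α (i + 1))) (Fin (α i)) ℂ) (i : ℕ) :
    (k : ℕ) → Matrix (Fin (α (i + k))) (Fin (α i)) ℂ
  | 0 => (1 : Matrix (Fin (α i)) (Fin (α i)) ℂ)
  | k + 1 => Y (i + k) * ysegFrom Y i k

/-- `xsegFrom X i k = X i * X (i+1) * ⋯ * X (i+k-1)`. -/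
def xsegFrom (X : ∀ i : ℕ, Matrix (Fin (α i)) (Fin (α (i + 1))) ℂ) (i : ℕ) :
    (k : ℕ) → Matrix (Fin (α i)) (Fin (α (i + k))) ℂ
  | 0 => (1 : Matrix (Fin (α i)) (Fin (α i)) ℂ)
  | k + 1 => xsegFrom X i k * X (i + k)

/-- A tuple `(X_i, Y_i, v, w)` of representation data for the framed cyclic quiver with
`m = p + 1` vertices `0, 1, …, p` (only the components with index `≤ p` are meaningful;
the remaining ones are required to vanish where relevant). -/
structure Datum (α : ℕ → ℕ) where
  X : ∀ i : ℕ, Matrix (Fin (α i)) (Fin (α (i + 1))) ℂ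
  Y : ∀ i : ℕ, Matrix (Fin (α (i + 1))) (Fin (α i)) ℂ
  v : Fin (α 0) → ℂ
  w : Fin (α 0) → ℂ

/-- The relations (qv1)–(qv2) for the deformed preprojective algebra of the framed
cyclic quiver with `m = p + 1` vertices. -/
def IsRepDatum (p : ℕ) (lam : ℕ → ℂ) (h0 : α (p + 1) = α 0) (d : Datum α) : Prop :=
  d.X 0 * d.Y 0 - recast h0 (d.Y p * d.X p) + vecMulVec d.v d.w
      = lam 0 • (1 : Matrix (Fin (α 0)) (Fin (α 0)) ℂ) ∧
    ∀ j : ℕ, j < p → d.X (j + 1) * d.Y (j + 1) - d.Y j * d.X j = lam (j + 1) • 1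

/-- `A = Y_{m-1} ⋯ Y_1 Y_0`, as a square matrix at the vertex `0`. -/
def Amat (p : ℕ) (h0 : α (p + 1) = α 0)
    (Y : ∀ i : ℕ, Matrix (Fin (α (i + 1))) (Fin (α i)) ℂ) :
    Matrix (Fin (α 0)) (Fin (α 0)) ℂ :=
  (yprod Y (p + 1)).submatrix (Fin.cast h0.symm) id

/-- `B = X_0 X_1 ⋯ X_{m-1}`, as a square matrix at the vertex `0`. -/
def Bmat (p : ℕ) (h0 : α (p + 1) = α 0)
    (X : ∀ i : ℕ, Matrix (Fin (α i)) (Fin (α (i + 1))) ℂ) :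
    Matrix (Fin (α 0)) (Fin (α 0)) ℂ :=
  (xprod X (p + 1)).submatrix id (Fin.cast h0.symm)

/-- `C_k = Y_{m-1} ⋯ Y_{m-k} X_{m-k} ⋯ X_{m-1}` (for `k ≤ m`; junk value `1` otherwise),
as a square matrix at the vertex `0`; `C_0 = Id`. -/
def Cmat (p : ℕ) (h0 : α (p + 1) = α 0)
    (X : ∀ i : ℕ, Matrix (Fin (α i)) (Fin (α (i + 1))) ℂ)
    (Y : ∀ i : ℕ, Matrix (Fin (α (i + 1))) (Fin (α i)) ℂ) (k : ℕ) :
    Matrix (Fin (α 0)) (Fin (α 0)) ℂ :=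
  if h : k ≤ p + 1 then
    recast ((congrArg α (by omega : p + 1 - k + k = p + 1)).trans h0)
      (ysegFrom Y (p + 1 - k) k * xsegFrom X (p + 1 - k) k)
  else 1

/-- `Y_{m-1} ⋯ Y_{i+1}` viewed as a matrix from vertex `i+1` to vertex `0` (zero for `i > p`). -/
def ycap (p : ℕ) (h0 : α (p + 1) = α 0)
    (Y : ∀ i : ℕ, Matrix (Fin (α (i + 1))) (Fin (α i)) ℂ) (i : ℕ) :
    Matrix (Fin (α 0)) (Fin (α (i + 1))) ℂ :=
  if h : i ≤ p then
    (ysegFrom Y (i + 1) (p - i)).submatrix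
      (Fin.cast (h0.symm.trans (congrArg α (by omega : p + 1 = i + 1 + (p - i))))) id
  else 0

/-- `X_{i+1} ⋯ X_{m-1}` viewed as a matrix from vertex `0` to vertex `i+1` (zero for `i > p`). -/
def xcap (p : ℕ) (h0 : α (p + 1) = α 0)
    (X : ∀ i : ℕ, Matrix (Fin (α i)) (Fin (α (i + 1))) ℂ) (i : ℕ) :
    Matrix (Fin (α (i + 1))) (Fin (α 0)) ℂ :=
  if h : i ≤ p then
    (xsegFrom X (i + 1) (p - i)).submatrix id
      (Fin.cast (h0.symm.trans (congrArg α (by omega : p + 1 = i + 1 + (p - i)))))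
  else 0

/-- The transformation `Ψ_{k,μ}`:
`X_i ↦ X_i + μ • Y_{i-1} ⋯ Y_0 (Y_{m-1} ⋯ Y_0)^{k-1} Y_{m-1} ⋯ Y_{i+1}`. -/
def psiT (p : ℕ) (h0 : α (p + 1) = α 0) (k : ℕ) (μ : ℂ) (d : Datum α) : Datum α where
  X := fun i => d.X i + μ • (yprod d.Y i * Amat p h0 d.Y ^ (k - 1) * ycap p h0 d.Y i)
  Y := d.Y
  v := d.v
  w := d.w

/-- The transformation `Φ_{k,ν}`:
`Y_i ↦ Y_i + ν • X_{i+1} ⋯ X_{m-1} (X_0 ⋯ X_{m-1})^{k-1} X_0 ⋯ X_{i-1}`. -/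
def phiT (p : ℕ) (h0 : α (p + 1) = α 0) (k : ℕ) (ν : ℂ) (d : Datum α) : Datum α where
  X := d.X
  Y := fun i => d.Y i + ν • (xcap p h0 d.X i * Bmat p h0 d.X ^ (k - 1) * xprod d.X i)
  v := d.v
  w := d.w

/-- Base change by a family of (invertible) matrices `g_i`. -/
def bcT (p : ℕ) (g : ∀ i : ℕ, Matrix (Fin (α i)) (Fin (α i)) ℂ) (d : Datum α) : Datum α where
  X := fun i => if i ≤ p then g i * d.X i * (g (i + 1))⁻¹ else d.X i
  Y := fun i => if i ≤ p then g (i + 1) * d.Y i * (g i)⁻¹ else d.Y i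
  v := g 0 *ᵥ d.v
  w := vecMul d.w (g 0)⁻¹

/-- One elementary move: a `Ψ_{k,μ}`, a `Φ_{k,ν}`, or a base change. -/
def Step (p : ℕ) (h0 : α (p + 1) = α 0) (d d' : Datum α) : Prop :=
  (∃ k : ℕ, ∃ μ : ℂ, 1 ≤ k ∧ d' = psiT p h0 k μ d) ∨
  (∃ k : ℕ, ∃ ν : ℂ, 1 ≤ k ∧ d' = phiT p h0 k ν d) ∨
  (∃ g : ∀ i : ℕ, Matrix (Fin (α i)) (Fin (α i)) ℂ,
      (∀ i, IsUnit (g i)) ∧ g (p + 1) = recast h0.symm (g 0) ∧ d' = bcT p g d)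

/-- `λ` is generic: `λ·β ≠ 0` for every root `β` of the affine quiver of type `Ã_{m-1}`. -/
def Generic (p : ℕ) (lam : ℕ → ℂ) : Prop :=
  (∑ t ∈ Finset.range (p + 1), lam t) ≠ 0 ∧
    ∀ i j : ℕ, 1 ≤ i → i ≤ j → j ≤ p → ∀ k : ℤ,
      (∑ t ∈ Finset.Icc i j, lam t) + (k : ℂ) * ∑ t ∈ Finset.range (p + 1), lam t ≠ 0


/-! ### A field with derivations -/

abbrev PR (M : ℕ) := MvPolynomial (Fin M) ℂ
abbrev GF (M : ℕ) := AlgebraicClosure (FractionRing (PR M))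

theorem gf_inj (M : ℕ) : Function.Injective (algebraMap (PR M) (GF M)) := by
  rw [IsScalarTower.algebraMap_eq (PR M) (FractionRing (PR M)) (GF M)]
  exact (FaithfulSMul.algebraMap_injective (FractionRing (PR M)) (GF M)).comp
    (IsFractionRing.injective (PR M) (FractionRing (PR M)))

theorem gf_etale (M : ℕ) : Algebra.FormallyEtale (PR M) (GF M) := by
  have : Algebra.FormallyEtale (PR M) (FractionRing (PR M)) :=
    Algebra.FormallyEtale.of_isLocalization (nonZeroDivisors (PR M))
  have : Algebra.FormallyEtale (FractionRing (PR M)) (GF M) :=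
    Algebra.FormallyEtale.of_isSeparable _ _
  exact Algebra.FormallyEtale.comp (PR M) (FractionRing (PR M)) (GF M)

theorem gf_deriv (M : ℕ) (k : Fin M) :
    ∃ D : Derivation ℂ (GF M) (GF M), ∀ x : PR M,
      D (algebraMap (PR M) (GF M) x) = algebraMap (PR M) (GF M) (MvPolynomial.pderiv k x) := by
  have := gf_etale M
  let d : Derivation ℂ (PR M) (GF M) :=
    (Algebra.linearMap (PR M) (GF M)).compDer (MvPolynomial.pderiv k)
  let l := d.liftKaehlerDifferential
  let L : TensorProduct (PR M) (GF M) (Ω[PR M⁄ℂ]) →ₗ[GF M] GF M :=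
    LinearMap.liftBaseChange (GF M) l
  let e := KaehlerDifferential.tensorKaehlerEquivOfFormallyEtale ℂ (PR M) (GF M)
  refine ⟨(L.comp e.symm.toLinearMap).compDer (KaehlerDifferential.D ℂ (GF M)), fun x => ?_⟩
  have h := KaehlerDifferential.tensorKaehlerEquivOfFormallyEtale_symm_D_algebraMap ℂ (PR M) (GF M) x
  change L (e.symm (KaehlerDifferential.D ℂ (GF M) (algebraMap (PR M) (GF M) x))) = _
  rw [h]
  simp [L, l, d]

/-! ### The core lemma -/

theorem core_indep {F ι : Type*} [Field F] [Fintype ι] [DecidableEq ι]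
    (X Y : Matrix ι ι F) (u : ι → F) (s : ℕ → F)
    (h : ∀ b, X *ᵥ (Y ^ (b + 1) *ᵥ u) = s b • (Y ^ b *ᵥ u)) (h0 : X *ᵥ u = 0)
    (hs : ∀ b, s b ≠ 0) : u = 0 := by
  by_contra hu
  have key : ∀ L : ℕ, ∀ q : ℕ → F, ∑ b ∈ Finset.range L, q b • (Y ^ b *ᵥ u) = 0 →
      ∀ b < L, q b = 0 := by
    intro L
    induction L with
    | zero => intro q _ b hb; omega
    | succ L ih =>
      intro q hq
      have h1 : ∑ b ∈ Finset.range L, (q (b + 1) * s b) • (Y ^ b *ᵥ u) = 0 := by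
        have := congrArg (fun z => X *ᵥ z) hq
        simp only [mulVec_zero] at this
        rw [← this, Finset.sum_range_succ', mulVec_add, mulVec_sum, mulVec_smul]
        simp [mulVec_smul, h, h0, smul_smul]
      have h2 := ih _ h1
      have h3 : ∀ b < L, q (b + 1) = 0 := fun b hb =>
        (mul_eq_zero.mp (h2 b hb)).resolve_right (hs b)
      rw [Finset.sum_range_succ'] at hq
      rw [Finset.sum_eq_zero (fun b hb => by rw [h3 b (Finset.mem_range.mp hb), zero_smul])] at hq
      simp [hu] at hq
      intro b hb
      rcases b with _ | b
      · exact hq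
      · exact h3 b (by omega)
  have hli : LinearIndependent F (fun b : ℕ => Y ^ b *ᵥ u) := by
    rw [linearIndependent_iff']
    intro S g hg i hi
    have := key (S.sup id + 1) (fun b => if b ∈ S then g b else 0) (by
      rw [← hg]
      simp only [ite_smul, zero_smul]
      rw [← Finset.sum_filter]
      apply Finset.sum_congr _ (fun _ _ => rfl)
      ext b
      simp only [Finset.mem_filter, Finset.mem_range]
      constructor
      · exact fun h => h.2
      · exact fun h => ⟨Nat.lt_succ_of_le (Finset.le_sup (f := id) h), h⟩) i
      (Nat.lt_succ_of_le (Finset.le_sup (f := id) hi))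
    simpa [hi] using this
  exact not_finite_iff_infinite.mpr (inferInstance : Infinite ℕ) hli.finite

theorem core {F ι : Type*} [Field F] [Fintype ι] [DecidableEq ι]
    (X Y Λ : Matrix ι ι F) (v w u u' : ι → F) (l l' : ℕ → F)
    (hrel : X * Y - Y * X + vecMulVec v w = Λ)
    (hl : ∀ d, Λ *ᵥ (Y ^ d *ᵥ u) = l d • (Y ^ d *ᵥ u))
    (hl' : ∀ c, (u' ᵥ* Y ^ c) ᵥ* Λ = l' c • (u' ᵥ* Y ^ c))
    (hXu : X *ᵥ u = 0) (hXu' : u' ᵥ* X = 0)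
    (hY : ∀ k, u' ⬝ᵥ (Y ^ k *ᵥ u) = 0)
    (hs : ∀ b, ∑ d ∈ Finset.range (b + 1), l d ≠ 0)
    (hs' : ∀ b, ∑ d ∈ Finset.range (b + 1), l' d ≠ 0)
    (hu : u ≠ 0) (hu' : u' ≠ 0) : False := by
  have hXY : X * Y = Y * X + Λ - vecMulVec v w := by rw [← hrel]; abel
  have hYX : Y * X = X * Y - Λ + vecMulVec v w := by rw [← hrel]; abel
  have stepR : ∀ b, X *ᵥ (Y ^ (b + 1) *ᵥ u) = Y *ᵥ (X *ᵥ (Y ^ b *ᵥ u)) + l b • (Y ^ b *ᵥ u)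
      - (w ⬝ᵥ (Y ^ b *ᵥ u)) • v := by
    intro b
    rw [pow_succ', ← mulVec_mulVec, mulVec_mulVec _ X Y, hXY, sub_mulVec, add_mulVec, hl,
      vecMulVec_mulVec, mulVec_mulVec _ Y X]
    simp
  have stepL : ∀ b, (u' ᵥ* Y ^ (b + 1)) ᵥ* X = ((u' ᵥ* Y ^ b) ᵥ* X) ᵥ* Y - l' b • (u' ᵥ* Y ^ b)
      + ((u' ᵥ* Y ^ b) ⬝ᵥ v) • w := by
    intro b
    rw [pow_succ, ← vecMul_vecMul, vecMul_vecMul _ Y X, hYX, vecMul_add, vecMul_sub, hl',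
      vecMul_vecMulVec, ← vecMul_vecMul]
  set φ : ℕ → F := fun a => (u' ᵥ* Y ^ a) ⬝ᵥ v with hφ
  set ψ : ℕ → F := fun b => w ⬝ᵥ (Y ^ b *ᵥ u) with hψ
  set G : ℕ → ℕ → F := fun a b => (u' ᵥ* Y ^ a) ⬝ᵥ (X *ᵥ (Y ^ b *ᵥ u)) with hG
  have hrec : ∀ a b, G a (b + 1) = G (a + 1) b - φ a * ψ b := by
    intro a b
    simp only [hG, hφ, hψ]
    rw [stepR, dotProduct_sub, dotProduct_add, dotProduct_smul, dotProduct_smul,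
      dotProduct_mulVec _ Y, vecMul_vecMul, ← pow_succ]
    have : (u' ᵥ* Y ^ a) ⬝ᵥ (Y ^ b *ᵥ u) = 0 := by
      rw [dotProduct_mulVec, vecMul_vecMul, ← pow_add, ← dotProduct_mulVec]; exact hY _
    rw [this]; simp [mul_comm]
  have hG0 : ∀ a, G a 0 = 0 := by intro a; simp [hG, hXu]
  have hG0' : ∀ b, G 0 b = 0 := by 
    intro b
    change (u' ᵥ* Y ^ 0) ⬝ᵥ (X *ᵥ (Y ^ b *ᵥ u)) = 0
    rw [dotProduct_mulVec, pow_zero, vecMul_one, hXu', zero_dotProduct]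
  have hconv : ∀ s, ∑ x ∈ Finset.HasAntidiagonal.antidiagonal s, φ x.1 * ψ x.2 = 0 := by
    intro s
    have : ∀ x ∈ Finset.HasAntidiagonal.antidiagonal s, φ x.1 * ψ x.2 =
        G (x.1 + 1) (s + 1 - (x.1 + 1)) - G x.1 (s + 1 - x.1) := by
      intro x hx
      rw [Finset.HasAntidiagonal.mem_antidiagonal] at hx
      have e1 : s + 1 - (x.1 + 1) = x.2 := by omega
      have e2 : s + 1 - x.1 = x.2 + 1 := by omega
      rw [e1, e2, hrec]; ring
    rw [Finset.sum_congr rfl this,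
      Finset.Nat.sum_antidiagonal_eq_sum_range_succ_mk]
    simp only
    rw [Finset.sum_range_sub (fun a => G a (s + 1 - a))]
    simp [hG0, hG0']
  have hprod : PowerSeries.mk φ * PowerSeries.mk ψ = 0 := by
    ext s
    rw [PowerSeries.coeff_mul]
    simpa using hconv s
  rcases mul_eq_zero.mp hprod with h | h
  · have hφ0 : ∀ a, φ a = 0 := fun a => by simpa using congrArg (PowerSeries.coeff a) h
    apply hu'
    refine core_indep Xᵀ Yᵀ u' (fun b => -∑ d ∈ Finset.range (b + 1), l' d) ?_ ?_
      (fun b => neg_ne_zero.mpr (hs' b))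
    · intro b
      simp only [← transpose_pow, mulVec_transpose]
      induction b with
      | zero => rw [stepL]; simp [hXu', show (u' ⬝ᵥ v) = 0 by simpa [hφ] using hφ0 0]
      | succ b ih =>
        rw [stepL, ih, show (u' ᵥ* Y ^ (b + 1)) ⬝ᵥ v = 0 from hφ0 _, smul_vecMul, vecMul_vecMul,
          ← pow_succ, Finset.sum_range_succ _ (b + 1), zero_smul, add_zero, neg_add, add_smul, neg_smul (l' _)]
        abel
    · rw [mulVec_transpose, hXu']
  · have hψ0 : ∀ a, ψ a = 0 := fun a => by simpa using congrArg (PowerSeries.coeff a) h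
    apply hu
    refine core_indep X Y u (fun b => ∑ d ∈ Finset.range (b + 1), l d) ?_ hXu hs
    intro b
    induction b with
    | zero => rw [stepR]; simp [hXu, show (w ⬝ᵥ u) = 0 by simpa [hψ] using hψ0 0]
    | succ b ih =>
      rw [stepR, ih, show w ⬝ᵥ (Y ^ (b + 1) *ᵥ u) = 0 from hψ0 _, mulVec_smul, mulVec_mulVec,
        ← pow_succ', Finset.sum_range_succ _ (b + 1), zero_smul, sub_zero, add_smul]


/-! ### Regularity -/

open Polynomial in
def del {R ι : Type*} [CommRing R] [Fintype ι] [DecidableEq ι] (M : Matrix ι ι R) : R :=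
  (aeval M (derivative M.charpoly)).det

open Polynomial in
theorem aeval_matrix_map {R S ι : Type*} [CommRing R] [CommRing S] [Fintype ι] [DecidableEq ι]
    (f : R →+* S) (M : Matrix ι ι R) (q : R[X]) :
    aeval (M.map f) (q.map f) = (aeval M q).map f := by
  have h1 : (aeval M q).map f = f.mapMatrix (aeval M q) := rfl
  have h2 : M.map f = f.mapMatrix M := rfl
  rw [h1, h2, aeval_def, aeval_def, hom_eval₂, eval₂_map]
  congr 1
  ext r i j
  by_cases h : i = j <;> simp [Matrix.algebraMap_matrix_apply, h]

open Polynomial in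
theorem del_map {R S ι : Type*} [CommRing R] [CommRing S] [Fintype ι] [DecidableEq ι]
    (f : R →+* S) (M : Matrix ι ι R) : del (M.map f) = f (del M) := by
  unfold del
  rw [f.map_det, Matrix.charpoly_map, derivative_map, aeval_matrix_map]
  rfl

open Polynomial in
theorem del_zero_root {F ι : Type*} [Field F] [IsAlgClosed F] [Fintype ι] [DecidableEq ι]
    (M : Matrix ι ι F) (h : del M = 0) :
    ∃ r, M.charpoly.eval r = 0 ∧ (derivative M.charpoly).eval r = 0 := by
  by_contra! hc
  have hcop : IsCoprime M.charpoly (derivative M.charpoly) := by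
    rw [isCoprime_iff_aeval_ne_zero_of_isAlgClosed F F]
    intro a
    by_cases h : M.charpoly.eval a = 0
    · right; simpa using hc a h
    · left; simpa using h
  obtain ⟨a, b, hab⟩ := hcop
  have := congrArg (aeval M) hab
  rw [map_add, map_mul, map_mul, aeval_self_charpoly, mul_zero, zero_add, map_one] at this
  have h2 := congrArg Matrix.det this
  rw [det_mul, det_one] at h2
  unfold del at h
  rw [h, mul_zero] at h2
  exact zero_ne_one h2

open Polynomial in
theorem del_zero_pair {F ι : Type*} [Field F] [IsAlgClosed F] [Fintype ι] [DecidableEq ι]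
    (M : Matrix ι ι F) (h : del M = 0) :
    ∃ (r : F) (u u' : ι → F), u ≠ 0 ∧ u' ≠ 0 ∧ M *ᵥ u = r • u ∧ u' ᵥ* M = r • u' ∧
      u' ⬝ᵥ u = 0 := by
  obtain ⟨r, hr, hr'⟩ := del_zero_root M h
  by_contra! hc
  have hc := hc r
  have hdet : (scalar ι r - M).det = 0 := by rw [← eval_charpoly, hr]
  obtain ⟨u, hu, huk⟩ := exists_mulVec_eq_zero_iff.mpr hdet
  obtain ⟨u', hu', huk'⟩ := exists_vecMul_eq_zero_iff.mpr hdet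
  have e1 : ∀ z, M *ᵥ z = r • z ↔ (scalar ι r - M) *ᵥ z = 0 := by
    intro z
    rw [sub_mulVec, sub_eq_zero, eq_comm]
    simp [← smul_one_eq_diagonal, smul_mulVec]
  have e2 : ∀ z, z ᵥ* M = r • z ↔ z ᵥ* (scalar ι r - M) = 0 := by
    intro z
    rw [vecMul_sub, sub_eq_zero, eq_comm]
    simp [← smul_one_eq_diagonal, vecMul_smul]
  have hne := hc u u' hu hu' ((e1 u).2 huk) ((e2 u').2 huk')
  set c := u' ⬝ᵥ u with hcdef
  set W := scalar ι r - M with hW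
  set P := c⁻¹ • vecMulVec u u' with hP
  have hPW : P * W = 0 := by
    rw [hP, smul_mul, vecMulVec_mul, huk']; ext; simp [vecMulVec_apply]
  have hPP : P * P = P := by
    rw [hP, smul_mul, mul_smul_comm, vecMulVec_mul_vecMulVec]
    ext i j
    simp only [Matrix.smul_apply, vecMulVec_apply, smul_eq_mul, Pi.smul_apply, ← hcdef]
    field_simp
  have hN : (P + W).det ≠ 0 := by
    intro h0
    obtain ⟨z, hz, hzk⟩ := exists_mulVec_eq_zero_iff.mpr h0
    have hPz : P *ᵥ z = 0 := by
      have := congrArg (fun y => P *ᵥ y) hzk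
      simpa [mulVec_mulVec, mul_add, hPW, hPP] using this
    have hWz : W *ᵥ z = 0 := by
      rw [add_mulVec, hPz, zero_add] at hzk; exact hzk
    apply hc z u' hz hu' ((e1 z).2 hWz) ((e2 u').2 huk')
    rw [hP, smul_mulVec, vecMulVec_mulVec] at hPz
    by_contra hne'
    apply hu
    ext i
    have := congrFun hPz i
    simpa [hne, hne'] using this
  -- polynomial identity
  set T : F[X] := X - C r with hT
  set P' := P.map (C : F →+* F[X]) with hP'
  set W' := W.map (C : F →+* F[X]) with hW'
  have hPW' : P' * W' = 0 := by
    rw [hP', hW', ← Matrix.map_mul, hPW]; ext; simp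
  have hPP' : P' * P' = P' := by
    rw [hP', ← Matrix.map_mul, hPP]
  have hfac : (1 + (T - 1) • P') * (T • (1 - P') + P' + W') = charmatrix M := by
    have : charmatrix M = T • 1 + W' := by
      ext i j
      by_cases hij : i = j
      · subst hij; simp [hT, hW', hW, charmatrix_apply]
      · simp [hT, hW', hW, charmatrix_apply, hij]
    rw [this]
    have h3 : P' * (T • (1 - P') + P' + W') = P' := by
      rw [mul_add, mul_add, mul_smul_comm, mul_sub, hPP', hPW', mul_one, sub_self, smul_zero, zero_add, add_zero]
    rw [add_mul, one_mul, smul_mul, h3]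
    simp only [smul_sub, sub_smul, one_smul]
    abel
  have hdetE : (1 + (T - 1) • P').det = T := by
    have : (T - 1) • P' = vecMulVec (fun i => (T - 1) * C (c⁻¹ * u i)) (fun i => C (u' i)) := by
      ext i j
      simp only [hP', hP, vecMulVec_apply, Matrix.smul_apply, map_apply, smul_eq_mul, map_mul]; ring
    rw [this, vecMulVec_eq Unit, det_one_add_replicateCol_mul_replicateRow]
    have : (fun i => C (u' i)) ⬝ᵥ (fun i => (T - 1) * C (c⁻¹ * u i)) = (T - 1) * C (c⁻¹ * c) := by
      rw [hcdef]
      simp only [dotProduct, map_mul, map_sum, Finset.mul_sum]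
      apply Finset.sum_congr rfl
      intros; ring
    rw [this, inv_mul_cancel₀ hne]; simp
  have hch : M.charpoly = T * (T • (1 - P') + P' + W').det := by
    nth_rewrite 1 [← hdetE]
    rw [← det_mul, hfac]; rfl
  rw [hch, derivative_mul] at hr'
  apply hN
  have : (P + W).det = eval r (T • (1 - P') + P' + W').det := by
    rw [← coe_evalRingHom, RingHom.map_det]
    congr 1
    ext i j
    simp [hT, hP', hW']
  rw [this]
  simpa [hT] using hr'

theorem reg_diag {n : ℕ} (M : Matrix (Fin n) (Fin n) ℂ) (h : del M ≠ 0) :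
    ∃ (P : Matrix (Fin n) (Fin n) ℂ) (a : Fin n → ℂ), IsUnit P ∧ Function.Injective a ∧
      M * P = P * diagonal a := by
  have hroot : ∀ r, M.charpoly.eval r = 0 → (Polynomial.derivative M.charpoly).eval r ≠ 0 := by
    intro r hr hr'
    apply h
    obtain ⟨s, hs⟩ := Polynomial.dvd_iff_isRoot.mpr hr'
    unfold del
    rw [hs, map_mul, det_mul]
    have : (Polynomial.aeval M (Polynomial.X - Polynomial.C r)).det = 0 := by
      rw [eval_charpoly] at hr
      rw [← neg_sub, map_neg, det_neg]
      have : (Polynomial.aeval M (Polynomial.C r - Polynomial.X)) = scalar _ r - M := by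
        simp; rfl
      rw [this, hr, mul_zero]
    rw [this, zero_mul]
  have hsep : M.charpoly.Separable := by
    unfold Polynomial.Separable
    rw [Polynomial.isCoprime_iff_aeval_ne_zero_of_isAlgClosed ℂ ℂ]
    intro a
    by_cases h : M.charpoly.eval a = 0
    · right; simpa using hroot a h
    · left; simpa using h
  have hcard := Polynomial.card_rootSet_eq_natDegree (K := ℂ) hsep (IsAlgClosed.splits _)
  rw [Matrix.charpoly_natDegree_eq_dim, Fintype.card_fin] at hcard
  let e : Fin n ≃ M.charpoly.rootSet ℂ := (Fintype.equivFinOfCardEq hcard).symm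
  have hex : ∀ i, ∃ u : Fin n → ℂ, u ≠ 0 ∧ M *ᵥ u = (e i : ℂ) • u := by
    intro i
    have h1 := (Polynomial.mem_rootSet.mp (e i).2).2
    have hdet : (scalar (Fin n) (e i : ℂ) - M).det = 0 := by
      rw [← eval_charpoly]; simpa using h1
    obtain ⟨u, hu, huk⟩ := exists_mulVec_eq_zero_iff.mpr hdet
    refine ⟨u, hu, ?_⟩
    rw [sub_mulVec, sub_eq_zero] at huk
    rw [← huk]
    simp [← smul_one_eq_diagonal, smul_mulVec]
  choose U hU hMU using hex
  have hinj : Function.Injective (fun i => (e i : ℂ)) := Subtype.val_injective.comp e.injective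
  have hli : LinearIndependent ℂ U := by
    refine Module.End.eigenvectors_linearIndependent' (Matrix.toLin' M) (fun i => (e i : ℂ)) hinj U ?_
    intro i
    refine ⟨?_, hU i⟩
    rw [Module.End.mem_eigenspace_iff]
    simpa using hMU i
  refine ⟨(Matrix.of U)ᵀ, fun i => (e i : ℂ), ?_, hinj, ?_⟩
  · rw [← Matrix.linearIndependent_cols_iff_isUnit]
    exact hli
  · ext i j
    have := congrFun (hMU j) i
    rw [mul_diagonal]
    simp only [mulVec, dotProduct, Pi.smul_apply, smul_eq_mul] at this
    simp only [mul_apply, transpose_apply, of_apply]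
    rw [this, mul_comm]

/-! ### Generic linear families of matrices -/

def lin {M : ℕ} {ι κ : Type*} (M0 : Matrix ι κ ℂ) (N : Fin M → Matrix ι κ ℂ) :
    Matrix ι κ (PR M) :=
  Matrix.of fun i j => MvPolynomial.C (M0 i j) + ∑ k, MvPolynomial.X k * MvPolynomial.C (N k i j)

theorem lin_eval {M : ℕ} {ι κ : Type*} (M0 : Matrix ι κ ℂ) (N : Fin M → Matrix ι κ ℂ)
    (t : Fin M → ℂ) :
    (lin M0 N).map (MvPolynomial.eval t) = M0 + ∑ k, t k • N k := by
  ext i j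
  simp [lin, Matrix.sum_apply]

theorem lin_gf {M : ℕ} {ι κ : Type*} (M0 : Matrix ι κ ℂ) (N : Fin M → Matrix ι κ ℂ) :
    (lin M0 N).map (algebraMap (PR M) (GF M)) = M0.map (algebraMap ℂ (GF M)) +
      ∑ k, algebraMap (PR M) (GF M) (MvPolynomial.X k) • (N k).map (algebraMap ℂ (GF M)) := by
  ext i j
  have : ∀ x : ℂ, algebraMap (PR M) (GF M) (MvPolynomial.C x) = algebraMap ℂ (GF M) x := fun x => by
    rw [IsScalarTower.algebraMap_apply ℂ (PR M) (GF M)]; rfl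
  simp [lin, Matrix.sum_apply, this, Algebra.smul_def]

theorem lin_deriv {M : ℕ} {ι κ : Type*} (M0 : Matrix ι κ ℂ) (N : Fin M → Matrix ι κ ℂ)
    (k : Fin M) (D : Derivation ℂ (GF M) (GF M)) (hD : ∀ x : PR M,
      D (algebraMap (PR M) (GF M) x) = algebraMap (PR M) (GF M) (MvPolynomial.pderiv k x)) :
    ((lin M0 N).map (algebraMap (PR M) (GF M))).map D = (N k).map (algebraMap ℂ (GF M)) := by
  ext i j
  have : ∀ x : ℂ, algebraMap (PR M) (GF M) (MvPolynomial.C x) = algebraMap ℂ (GF M) x := fun x => by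
    rw [IsScalarTower.algebraMap_apply ℂ (PR M) (GF M)]; rfl
  rw [map_apply, map_apply, hD, map_apply, ← this]
  congr 1
  simp [lin, MvPolynomial.pderiv_X, Pi.single_apply]

theorem deriv_pair {F ι κ : Type*} [Field F] [Algebra ℂ F] [Fintype ι] [Fintype κ]
    (D : Derivation ℂ F F) (M : Matrix ι κ F) (u : κ → F) (u' : ι → F)
    (hu : M *ᵥ u = 0) (hu' : u' ᵥ* M = 0) : u' ⬝ᵥ (M.map D *ᵥ u) = 0 := by
  have h : M.map D *ᵥ u = - (M *ᵥ (fun j => D (u j))) := by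
    ext i
    have := congrArg D (congrFun hu i)
    simp only [mulVec, dotProduct, Pi.zero_apply, map_zero, map_sum, Derivation.leibniz,
      smul_eq_mul, Finset.sum_add_distrib] at this
    simp only [mulVec, dotProduct, Pi.neg_apply, map_apply]
    rw [eq_neg_iff_add_eq_zero, ← this, add_comm]
    simp only [mul_comm]
  rw [h, dotProduct_neg, dotProduct_mulVec, hu', zero_dotProduct, neg_zero]

theorem pow_functional {F ι : Type*} [Field F] [Fintype ι] [DecidableEq ι] (n : ℕ)
    (hn : Fintype.card ι ≤ n) (A : Matrix ι ι F) (L : Matrix ι ι F →ₗ[F] F)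
    (h : ∀ k < n, L (A ^ k) = 0) (k : ℕ) : L (A ^ k) = 0 := by
  rw [Matrix.pow_eq_aeval_mod_charpoly]
  by_cases h0 : (Polynomial.X ^ k %ₘ A.charpoly) = 0
  · rw [h0]; simp
  have hd : (Polynomial.X ^ k %ₘ A.charpoly).natDegree < n := by
    have := Polynomial.degree_modByMonic_lt (Polynomial.X ^ k) A.charpoly_monic
    have := Polynomial.natDegree_lt_natDegree h0 this
    rw [Matrix.charpoly_natDegree_eq_dim] at this
    omega
  rw [Polynomial.aeval_eq_sum_range' hd, map_sum]
  apply Finset.sum_eq_zero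
  intro i hi
  rw [map_smul, h i (Finset.mem_range.mp hi), smul_zero]

theorem exists_eval_ne {M : ℕ} (P : PR M) (h : P ≠ 0) : ∃ t, MvPolynomial.eval t P ≠ 0 := by
  by_contra! hc
  exact h (MvPolynomial.funext (by simpa using hc))

theorem shiota {n : ℕ} (S H : Matrix (Fin n) (Fin n) ℂ) (κ : ℂ) (hκ : κ ≠ 0) (v w : Fin n → ℂ)
    (hrel : S * H - H * S + vecMulVec v w = κ • 1) :
    ∃ g : Polynomial ℂ, del (S + Polynomial.aeval H g) ≠ 0 := by
  set Sp : Matrix (Fin n) (Fin n) (PR n) := lin S (fun k => H ^ (k : ℕ)) with hSp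
  by_cases hdel : del Sp = 0
  swap
  · obtain ⟨t, ht⟩ := exists_eval_ne _ hdel
    rw [← del_map, hSp, lin_eval] at ht
    refine ⟨∑ k, Polynomial.C (t k) * Polynomial.X ^ (k : ℕ), ?_⟩
    convert ht using 3
    simp [Algebra.smul_def]
  exfalso
  have h1 : del (Sp.map (algebraMap (PR n) (GF n))) = 0 := by rw [del_map, hdel, map_zero]
  obtain ⟨r, u, u', hu, hu', hMu, hMu', huu⟩ := del_zero_pair _ h1
  set H' := H.map (algebraMap ℂ (GF n)) with hH'
  set S' := Sp.map (algebraMap (PR n) (GF n)) with hS'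
  have hHpow : ∀ k, (H ^ k).map (algebraMap ℂ (GF n)) = H' ^ k := fun k =>
    map_pow (algebraMap ℂ (GF n)).mapMatrix H k
  have hS'u : (S' - r • 1) *ᵥ u = 0 := by rw [sub_mulVec, hMu, smul_mulVec, one_mulVec, sub_self]
  have hS'u' : u' ᵥ* (S' - r • 1) = 0 := by rw [vecMul_sub, hMu', vecMul_smul, vecMul_one, sub_self]
  have hYk : ∀ k < n, u' ⬝ᵥ (H' ^ k *ᵥ u) = 0 := by
    intro k hk
    obtain ⟨D, hD⟩ := gf_deriv n ⟨k, hk⟩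
    have h2 := deriv_pair D _ u u' hS'u hS'u'
    have h3 : (S' - r • (1 : Matrix (Fin n) (Fin n) (GF n))).map D = H' ^ k - D r • 1 := by
      have h4 := lin_deriv S (fun k : Fin n => H ^ (k : ℕ)) _ D hD
      rw [← hSp, ← hS'] at h4
      simp only [hHpow] at h4
      rw [← h4]
      ext i j
      by_cases hij : i = j <;> simp [hij]
    rw [h3, sub_mulVec, smul_mulVec, one_mulVec, dotProduct_sub, dotProduct_smul, huu] at h2
    simpa using h2
  have hY : ∀ k, u' ⬝ᵥ (H' ^ k *ᵥ u) = 0 := by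
    intro k
    let L : Matrix (Fin n) (Fin n) (GF n) →ₗ[GF n] GF n :=
      { toFun := fun A => u' ⬝ᵥ (A *ᵥ u)
        map_add' := fun A B => by rw [add_mulVec, dotProduct_add]
        map_smul' := fun c A => by rw [smul_mulVec, dotProduct_smul]; rfl }
    exact pow_functional n (by simp) H' L hYk k
  have hcomm : ∀ k, Commute ((H ^ k).map (algebraMap ℂ (GF n))) H' := fun k => by
    rw [hHpow]; exact (Commute.refl H').pow_left k
  have hrel' : (S' - r • 1) * H' - H' * (S' - r • 1) +
      vecMulVec (fun i => algebraMap ℂ (GF n) (v i)) (fun i => algebraMap ℂ (GF n) (w i)) =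
      algebraMap ℂ (GF n) κ • 1 := by
    have e1 : S' * H' - H' * S' = S.map (algebraMap ℂ (GF n)) * H' - H' * S.map (algebraMap ℂ (GF n)) := by
      rw [hS', hSp, lin_gf]
      have : ∀ Q : Matrix (Fin n) (Fin n) (GF n), Commute Q H' → ∀ R, (R + Q) * H' - H' * (R + Q) = R * H' - H' * R := by
        intro Q hQ R
        rw [add_mul, mul_add, hQ.eq]; abel
      apply this
      apply Commute.sum_left
      intro k _
      exact (hcomm k).smul_left _
    have e2 : (S' - r • 1) * H' - H' * (S' - r • 1) = S' * H' - H' * S' := by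
      rw [sub_mul, mul_sub]; simp
    rw [e2, e1, hH', ← Matrix.map_mul, ← Matrix.map_mul]
    ext i j
    have := congrArg (algebraMap ℂ (GF n)) (congrFun (congrFun hrel i) j)
    by_cases hij : i = j
    · subst hij; simpa [vecMulVec_apply, -Matrix.map_mul] using this
    · simpa [vecMulVec_apply, hij, -Matrix.map_mul] using this
  have hk0 : algebraMap ℂ (GF n) κ ≠ 0 := by simpa using hκ
  have hsum : ∀ b, ∑ d ∈ Finset.range (b + 1), (fun _ : ℕ => algebraMap ℂ (GF n) κ) d ≠ 0 := by
    intro b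
    simp only [Finset.sum_const, Finset.card_range, nsmul_eq_mul]
    exact mul_ne_zero (by exact_mod_cast Nat.succ_ne_zero b) hk0
  exact core _ H' _ _ _ u u' (fun _ => algebraMap ℂ (GF n) κ) (fun _ => algebraMap ℂ (GF n) κ) hrel'
    (fun d => by rw [smul_mulVec, one_mulVec]) (fun d => by rw [vecMul_smul, vecMul_one])
    hS'u hS'u' hY hsum hsum hu hu'

/-! ### Matrix roots -/

open Polynomial in
theorem multiset_dvd_pow (s : Multiset ℂ) (q : ℂ[X]) (h : ∀ a ∈ s, (X - C a) ∣ q) :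
    (s.map (fun a => X - C a)).prod ∣ q ^ Multiset.card s := by
  induction s using Multiset.induction with
  | empty => simp
  | cons a s ih =>
    rw [Multiset.map_cons, Multiset.prod_cons, Multiset.card_cons, pow_succ']
    exact mul_dvd_mul (h a (by simp)) (ih fun b hb => h b (by simp [hb]))

open Polynomial in
theorem matrix_root {n : ℕ} (A : Matrix (Fin n) (Fin n) ℂ) (hA : IsUnit A) (m : ℕ) (hm : m ≠ 0) :
    ∃ h : ℂ[X], (aeval A h) ^ m = A := by
  classical
  set χ := A.charpoly with hχ
  have hχ0 : χ ≠ 0 := A.charpoly_monic.ne_zero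
  have hroot0 : ∀ a ∈ χ.roots, a ≠ 0 := by
    intro a ha h0
    rw [mem_roots hχ0, IsRoot, h0, hχ, eval_charpoly] at ha
    have := (isUnit_iff_isUnit_det A).mp hA
    simp only [map_zero, zero_sub, det_neg] at ha
    apply this.ne_zero
    simpa using ha
  have hr : ∀ a : ℂ, ∃ z, z ^ m = a := fun a => IsAlgClosed.exists_pow_nat_eq a (Nat.pos_of_ne_zero hm)
  choose ρ hρ using hr
  set h0 := Lagrange.interpolate χ.roots.toFinset id ρ with hh0
  have heval : ∀ a ∈ χ.roots, eval a h0 = ρ a := by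
    intro a ha
    exact Lagrange.eval_interpolate_at_node (v := id) ρ Function.injective_id.injOn
      (Multiset.mem_toFinset.mpr ha)
  have hdvd : χ ∣ (h0 ^ m - X) ^ Multiset.card χ.roots := by
    have h1 := multiset_dvd_pow χ.roots (h0 ^ m - X) (fun a ha => by
      rw [dvd_iff_isRoot, IsRoot, eval_sub, eval_pow, heval a ha, hρ, eval_X, sub_self])
    have h2 := (IsAlgClosed.splits χ).eq_prod_roots_of_monic A.charpoly_monic
    rw [← h2] at h1
    exact h1
  have hcop : IsCoprime h0 χ := by
    rw [isCoprime_iff_aeval_ne_zero_of_isAlgClosed ℂ ℂ]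
    intro a
    by_cases h : χ.eval a = 0
    · left
      have ha : a ∈ χ.roots := (mem_roots hχ0).mpr h
      simp only [coe_aeval_eq_eval]
      rw [heval a ha]
      intro hz
      have := hρ a
      rw [hz, zero_pow hm] at this
      exact hroot0 a ha this.symm
    · right; simpa using h
  let P : (AdjoinRoot χ)[X] := X ^ m - C (AdjoinRoot.mk χ X)
  let x : AdjoinRoot χ := AdjoinRoot.mk χ h0
  have hxu : IsUnit x := by
    obtain ⟨a, b, hab⟩ := hcop
    refine IsUnit.of_mul_eq_one (AdjoinRoot.mk χ a) ?_
    have := congrArg (AdjoinRoot.mk χ) hab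
    rw [map_add, map_mul, map_mul, AdjoinRoot.mk_self, mul_zero, add_zero, map_one] at this
    rw [mul_comm]; exact this
  have hn : IsNilpotent (aeval x P) := by
    refine ⟨Multiset.card χ.roots, ?_⟩
    have : aeval x P = AdjoinRoot.mk χ (h0 ^ m - X) := by simp [P, x]
    rw [this, ← map_pow, AdjoinRoot.mk_eq_zero]
    exact hdvd
  have hu : IsUnit (aeval x (derivative P)) := by
    have : aeval x (derivative P) = AdjoinRoot.mk χ (C (m : ℂ)) * x ^ (m - 1) := by
      simp [P, derivative_X_pow]
    rw [this]
    refine IsUnit.mul ?_ (hxu.pow _)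
    exact (IsUnit.map C (by simpa using hm)).map (AdjoinRoot.mk χ)
  obtain ⟨r, ⟨-, hr⟩, -⟩ := existsUnique_nilpotent_sub_and_aeval_eq_zero hn hu
  obtain ⟨h, rfl⟩ := AdjoinRoot.mk_surjective r
  refine ⟨h, ?_⟩
  have h1 : AdjoinRoot.mk χ (h ^ m - X) = 0 := by
    rw [← hr]; simp [P]
  rw [AdjoinRoot.mk_eq_zero] at h1
  obtain ⟨s, hs⟩ := h1
  have := congrArg (aeval A) hs
  rw [map_mul, hχ, aeval_self_charpoly, zero_mul, map_sub, map_pow, aeval_X, sub_eq_zero] at this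
  exact this

/-! ### Ordered products -/

def ncp {M : Type*} [Monoid M] (f : ℕ → M) : ℕ → M
  | 0 => 1
  | k + 1 => ncp f k * f k

theorem ncp_map {M N : Type*} [Monoid M] [Monoid N] (φ : M →* N) (f : ℕ → M) (k : ℕ) :
    φ (ncp f k) = ncp (fun i => φ (f i)) k := by
  induction k with
  | zero => simp [ncp]
  | succ k ih => simp [ncp, ih]

theorem ncp_smul {R M : Type*} [CommRing R] [Ring M] [Algebra R M] (c : R) (f : ℕ → M) (k : ℕ) :
    ncp (fun i => c • f i) k = c ^ k • ncp f k := by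
  induction k with
  | zero => simp [ncp]
  | succ k ih => simp [ncp, ih, smul_smul, pow_succ, mul_comm]

/-- noncommutative first-order expansion -/
def nsum {M : Type*} [Ring M] (H : M) (U : ℕ → M) : ℕ → M
  | 0 => 0
  | k + 1 => nsum H U k * H + H ^ k * U k

theorem nsum_comm {M : Type*} [Ring M] (H Z : M) (k : ℕ) :
    nsum H (fun _ => Z) k * H - H * nsum H (fun _ => Z) k = Z * H ^ k - H ^ k * Z := by
  induction k with
  | zero => simp [nsum]
  | succ k ih =>
    have : nsum H (fun _ => Z) (k + 1) * H - H * nsum H (fun _ => Z) (k + 1) =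
      (nsum H (fun _ => Z) k * H - H * nsum H (fun _ => Z) k) * H + H ^ k * Z * H - H * H ^ k * Z := by
      simp only [nsum]; noncomm_ring
    rw [this, ih, ← pow_succ', pow_succ, sub_mul]
    noncomm_ring

theorem nsum_split {M : Type*} [Ring M] [Algebra ℂ M] (H Z G : M) (hG : Commute G H) (c : ℕ → ℂ) (k : ℕ) :
    nsum H (fun l => Z + G + algebraMap ℂ M (c l)) k * H = nsum H (fun _ => Z) k * H +
      ((k : ℂ) • G + algebraMap ℂ M (∑ l ∈ Finset.range k, c l)) * H ^ k := by
  induction k with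
  | zero => simp [nsum]
  | succ k ih =>
    rw [nsum, nsum, add_mul, ih, add_mul _ _ H, Finset.sum_range_succ, map_add]
    have h1 : H ^ k * G = G * H ^ k := (hG.pow_right k).eq.symm
    have h2 : H ^ k * algebraMap ℂ M (c k) = algebraMap ℂ M (c k) * H ^ k :=
      (Algebra.commutes _ _).symm
    rw [mul_add, mul_add, h1, h2]
    push_cast
    rw [add_smul, one_smul, pow_succ]
    noncomm_ring

theorem ncp_expand {n : ℕ} (H : Matrix (Fin n) (Fin n) ℂ) (U : ℕ → Matrix (Fin n) (Fin n) ℂ) (k : ℕ) :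
    ∃ N : Matrix (Fin n) (Fin n) (Polynomial ℂ),
      ncp (fun l => H.map Polynomial.C + (Polynomial.X : Polynomial ℂ) • (U l).map Polynomial.C) k =
        (H ^ k).map Polynomial.C + (Polynomial.X : Polynomial ℂ) • N ∧
      N.map (Polynomial.eval 0) = nsum H U k := by
  induction k with
  | zero => exact ⟨0, by simp [ncp], by ext; simp [nsum]⟩
  | succ k ih =>
    obtain ⟨N, hN, hN0⟩ := ih
    refine ⟨N * H.map Polynomial.C + (H ^ k).map Polynomial.C * (U k).map Polynomial.C +
      (Polynomial.X : Polynomial ℂ) • (N * (U k).map Polynomial.C), ?_, ?_⟩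
    · rw [ncp, hN, pow_succ, Matrix.map_mul]
      simp only [add_mul, mul_add, smul_mul, mul_smul_comm, smul_add]
      abel
    · rw [nsum, ← hN0]
      have : ∀ Q : Matrix (Fin n) (Fin n) (Polynomial ℂ), Q.map (Polynomial.eval 0) =
        (Polynomial.evalRingHom (0 : ℂ)).mapMatrix Q := fun _ => rfl
      have hC : ∀ Q : Matrix (Fin n) (Fin n) ℂ, (Polynomial.evalRingHom (0 : ℂ)).mapMatrix (Q.map Polynomial.C) = Q := by
        intro Q; ext; simp
      have hX : ∀ Q : Matrix (Fin n) (Fin n) (Polynomial ℂ), (Polynomial.evalRingHom (0 : ℂ)).mapMatrix ((Polynomial.X : Polynomial ℂ) • Q) = 0 := by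
        intro Q; ext; simp
      rw [this, this, map_add, map_add, map_mul, map_mul, hX, hC, hC, hC, add_zero]

theorem step2_matrix {n : ℕ} (m : ℕ) (hm : m ≠ 0) (A Z : Matrix (Fin n) (Fin n) ℂ) (hA : IsUnit A)
    (κ : ℂ) (hκ : κ ≠ 0) (v w : Fin n → ℂ)
    (hrel : Z * A - A * Z = κ • A - vecMulVec v w * A) (c : ℕ → ℂ) :
    ∃ (F : Polynomial ℂ) (P : Matrix (Fin n) (Fin n) ℂ) (b : Fin n → ℂ), IsUnit P ∧
      Function.Injective b ∧ (∀ i, b i ≠ 0) ∧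
      ncp (fun l => Z + Polynomial.aeval A F + algebraMap ℂ _ (c l)) m * A⁻¹ * P = P * diagonal b := by
  obtain ⟨h, hh⟩ := matrix_root A hA m hm
  set H := Polynomial.aeval A h with hH
  have hAd := (isUnit_iff_isUnit_det A).mp hA
  have hAH : Commute A H := by rw [← hh]; exact (Commute.refl H).pow_left m
  have hAiH : Commute A⁻¹ H := by
    change A⁻¹ * H = H * A⁻¹
    have : A⁻¹ * (A * H) * A⁻¹ = A⁻¹ * (H * A) * A⁻¹ := by rw [hAH.eq]
    rw [nonsing_inv_mul_cancel_left _ _ hAd, ← mul_assoc, mul_nonsing_inv_cancel_right _ _ hAd] at this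
    exact this.symm
  have hHH : IsUnit H := by
    rw [← isUnit_pow_iff hm, hh]; exact hA
  have hHd := (isUnit_iff_isUnit_det H).mp hHH
  set S := nsum H (fun _ => Z) m * A⁻¹ with hS
  have hSH : S * H - H * S + vecMulVec v w = κ • 1 := by
    have h1 : S * H - H * S = (nsum H (fun _ => Z) m * H - H * nsum H (fun _ => Z) m) * A⁻¹ := by
      rw [hS, mul_assoc, hAiH.eq]; noncomm_ring
    rw [h1, nsum_comm, hh, hrel, sub_mul, mul_nonsing_inv_cancel_right _ _ hAd, smul_mul, mul_nonsing_inv _ hAd]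
    abel
  obtain ⟨g, hg⟩ := shiota S H κ hκ v w hSH
  have hmC : (m : ℂ) ≠ 0 := by exact_mod_cast hm
  set gp : Polynomial ℂ := Polynomial.C (m : ℂ)⁻¹ * (g * Polynomial.X - Polynomial.C (∑ l ∈ Finset.range m, c l)) with hgp
  set G := Polynomial.aeval H gp with hG
  have hGH : Commute G H := by
    have := Polynomial.aeval_X (R := ℂ) H
    change _ * _ = _ * _
    nth_rewrite 1 [← this]
    nth_rewrite 2 [← this]
    rw [hG, ← map_mul, ← map_mul, mul_comm]
  set U : ℕ → Matrix (Fin n) (Fin n) ℂ := fun l => Z + G + algebraMap ℂ _ (c l) with hU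
  obtain ⟨N, hN, hN0⟩ := ncp_expand H U m
  have hmG : ((m : ℂ) • G + algebraMap ℂ _ (∑ l ∈ Finset.range m, c l)) = Polynomial.aeval H g * H := by
    rw [hG, hgp]
    simp only [map_mul, map_sub, Polynomial.aeval_C, Polynomial.aeval_X, ← Algebra.smul_def]
    rw [smul_smul, mul_inv_cancel₀ hmC, one_smul, sub_add_cancel]
  have hNS : nsum H U m * A⁻¹ = S + Polynomial.aeval H g := by
    have h1 := nsum_split H Z G hGH c m
    have h2 : nsum H U m * H = (nsum H (fun _ => Z) m + Polynomial.aeval H g * A) * H := by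
      rw [h1, hmG, hh, add_mul, mul_assoc (Polynomial.aeval H g) H A, ← hAH.eq, mul_assoc]
    have h3 : nsum H U m = nsum H (fun _ => Z) m + Polynomial.aeval H g * A := by
      have := congrArg (fun Q => Q * H⁻¹) h2
      simpa only [mul_nonsing_inv_cancel_right _ _ hHd] using this
    rw [h3, add_mul, mul_nonsing_inv_cancel_right _ _ hAd]
  set Ai := (A⁻¹).map (Polynomial.C : ℂ →+* Polynomial ℂ) with hAi
  set Np := N * Ai with hNp
  have hmap : ∀ (e : ℂ) (Q : Matrix (Fin n) (Fin n) (Polynomial ℂ)), Q.map (Polynomial.eval e) =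
    (Polynomial.evalRingHom e).mapMatrix Q := fun _ _ => rfl
  have hC : ∀ (e : ℂ) (Q : Matrix (Fin n) (Fin n) ℂ),
      (Polynomial.evalRingHom e).mapMatrix (Q.map Polynomial.C) = Q := by
    intro e Q; ext; simp
  have hX : ∀ (e : ℂ) (Q : Matrix (Fin n) (Fin n) (Polynomial ℂ)),
      (Polynomial.evalRingHom e).mapMatrix ((Polynomial.X : Polynomial ℂ) • Q) =
        e • (Polynomial.evalRingHom e).mapMatrix Q := by
    intro e Q; ext; simp
  have hone : (A ^ 1).map (Polynomial.C : ℂ →+* Polynomial ℂ) * Ai = 1 := by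
    rw [hAi, ← Matrix.map_mul, pow_one, mul_nonsing_inv _ hAd]; ext i j; simp [Matrix.one_apply]
  have hexp : ncp (fun l => H.map Polynomial.C + (Polynomial.X : Polynomial ℂ) • (U l).map Polynomial.C) m
      * Ai = 1 + (Polynomial.X : Polynomial ℂ) • Np := by
    rw [hN, hh, add_mul, smul_mul, ← hNp, ← pow_one A, hone]
  have hNp0 : (Polynomial.evalRingHom (0 : ℂ)).mapMatrix Np = S + Polynomial.aeval H g := by
    rw [hNp, map_mul, ← hmap, hN0, hAi, hC, hNS]
  have hd0 : (del Np).eval 0 ≠ 0 := by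
    have := del_map (Polynomial.evalRingHom (0 : ℂ)) Np
    change _ = (del Np).eval 0 at this
    rw [← this]
    change del ((Polynomial.evalRingHom (0 : ℂ)).mapMatrix Np) ≠ 0
    rw [hNp0]; exact hg
  have hdet0 : ((1 + (Polynomial.X : Polynomial ℂ) • Np).det).eval 0 ≠ 0 := by
    rw [← Polynomial.coe_evalRingHom, RingHom.map_det, map_add, map_one, hX, zero_smul, add_zero, det_one]
    exact one_ne_zero
  obtain ⟨e, he⟩ : ∃ e : ℂ, (Polynomial.X * del Np * (1 + (Polynomial.X : Polynomial ℂ) • Np).det).eval e ≠ 0 := by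
    by_contra! hc
    have h0 : Polynomial.X * del Np * (1 + (Polynomial.X : Polynomial ℂ) • Np).det = 0 :=
      Polynomial.funext (by simpa using hc)
    rcases mul_eq_zero.mp h0 with h0 | h0
    · rcases mul_eq_zero.mp h0 with h0 | h0
      · exact Polynomial.X_ne_zero h0
      · rw [h0] at hd0; simp at hd0
    · rw [h0] at hdet0; simp at hdet0
  rw [Polynomial.eval_mul, Polynomial.eval_mul, Polynomial.eval_X] at he
  have he0 : e ≠ 0 := fun h => he (by rw [h]; simp)
  have hed : (del Np).eval e ≠ 0 := fun h => he (by rw [h]; simp)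
  have hedet : ((1 + (Polynomial.X : Polynomial ℂ) • Np).det).eval e ≠ 0 := fun h => he (by rw [h]; simp)
  set Ne := (Polynomial.evalRingHom e).mapMatrix Np with hNe
  have hdNe : del Ne ≠ 0 := by
    have := del_map (Polynomial.evalRingHom e) Np
    change del Ne = (del Np).eval e at this
    rw [this]; exact hed
  obtain ⟨P, a, hP, ha, hPa⟩ := reg_diag Ne hdNe
  have hPd := (isUnit_iff_isUnit_det P).mp hP
  have hB : ncp (fun l => H + e • U l) m * A⁻¹ = 1 + e • Ne := by
    have := congrArg (Polynomial.evalRingHom e).mapMatrix hexp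
    rw [map_mul, map_add, hX, map_one, hAi, hC] at this
    rw [hNe, ← this]
    congr 1
    have h5 := ncp_map ((Polynomial.evalRingHom e).mapMatrix : Matrix (Fin n) (Fin n) (Polynomial ℂ) →+* Matrix (Fin n) (Fin n) ℂ).toMonoidHom
      (fun l => H.map Polynomial.C + (Polynomial.X : Polynomial ℂ) • (U l).map Polynomial.C) m
    refine Eq.trans ?_ h5.symm
    congr 1
    ext1 l
    symm
    change (Polynomial.evalRingHom e).mapMatrix _ = _
    rw [map_add, hX, hC, hC]
  have hBP : (1 + e • Ne) * P = P * diagonal (fun i => 1 + e * a i) := by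
    have : diagonal (fun i => 1 + e * a i) = 1 + e • diagonal a := by
      ext i j; by_cases hij : i = j
      · subst hij; simp
      · simp [hij]
    rw [this, add_mul, smul_mul, hPa, mul_add, mul_smul_comm, one_mul, mul_one]
  refine ⟨Polynomial.C e⁻¹ * h + gp.comp h, P, fun i => e⁻¹ ^ m * (1 + e * a i), hP, ?_, ?_, ?_⟩
  · intro i j hij
    have h1 : e⁻¹ ^ m ≠ 0 := pow_ne_zero _ (inv_ne_zero he0)
    have h2 := mul_left_cancel₀ h1 hij
    exact ha (mul_left_cancel₀ he0 (add_left_cancel h2))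
  · intro i hi
    have h1 : e⁻¹ ^ m ≠ 0 := pow_ne_zero _ (inv_ne_zero he0)
    have h2 := (mul_eq_zero.mp hi).resolve_left h1
    apply hedet
    rw [← Polynomial.coe_evalRingHom, RingHom.map_det, map_add, map_one, hX, ← hNe]
    have h3 := congrArg Matrix.det hBP
    rw [det_mul, det_mul, det_diagonal, Finset.prod_eq_zero (Finset.mem_univ i) h2, mul_zero] at h3
    exact (mul_eq_zero.mp h3).resolve_right hPd.ne_zero
  · have h1 : (fun l => Z + Polynomial.aeval A (Polynomial.C e⁻¹ * h + gp.comp h) + algebraMap ℂ (Matrix (Fin n) (Fin n) ℂ) (c l)) =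
        fun l => e⁻¹ • (H + e • U l) := by
      ext1 l
      rw [smul_add, smul_smul, inv_mul_cancel₀ he0, one_smul, map_add, map_mul, Polynomial.aeval_C,
        Polynomial.aeval_comp, ← Algebra.smul_def]
      change Z + (e⁻¹ • H + G) + _ = e⁻¹ • H + (Z + G + _)
      abel
    rw [h1, ncp_smul, smul_mul, hB, smul_mul, hBP]
    have : diagonal (fun i => e⁻¹ ^ m * (1 + e * a i)) = e⁻¹ ^ m • diagonal (fun i => 1 + e * a i) := by
      rw [← diagonal_smul]; rfl
    rw [this, mul_smul_comm]

theorem diag_of_roots {n : ℕ} (M : Matrix (Fin n) (Fin n) ℂ) (a : Fin n → ℂ)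
    (ha : Function.Injective a) (hdet : ∀ i, (a i • 1 - M).det = 0) :
    ∃ P : Matrix (Fin n) (Fin n) ℂ, IsUnit P ∧ M * P = P * diagonal a := by
  have hex : ∀ i, ∃ u : Fin n → ℂ, u ≠ 0 ∧ M *ᵥ u = a i • u := by
    intro i
    obtain ⟨u, hu, huk⟩ := exists_mulVec_eq_zero_iff.mpr (hdet i)
    refine ⟨u, hu, ?_⟩
    rw [sub_mulVec, sub_eq_zero] at huk
    rw [← huk]
    simp [smul_mulVec]
  choose U hU hMU using hex
  have hli : LinearIndependent ℂ U := by
    refine Module.End.eigenvectors_linearIndependent' (Matrix.toLin' M) a ha U ?_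
    intro i
    refine ⟨?_, hU i⟩
    rw [Module.End.mem_eigenspace_iff]
    simpa using hMU i
  refine ⟨(Matrix.of U)ᵀ, ?_, ?_⟩
  · rw [← Matrix.linearIndependent_cols_iff_isUnit]
    exact hli
  · ext i j
    have := congrFun (hMU j) i
    rw [mul_diagonal]
    simp only [mulVec, dotProduct, Pi.smul_apply, smul_eq_mul] at this
    simp only [mul_apply, transpose_apply, of_apply]
    rw [this, mul_comm]

theorem aeval_conj {n : ℕ} (A P D : Matrix (Fin n) (Fin n) ℂ) (h : A * P = P * D)
    (F : Polynomial ℂ) : Polynomial.aeval A F * P = P * Polynomial.aeval D F := by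
  have hk : ∀ k : ℕ, A ^ k * P = P * D ^ k := by
    intro k
    induction k with
    | zero => simp
    | succ k ih => rw [pow_succ, mul_assoc, h, ← mul_assoc, ih, mul_assoc, ← pow_succ]
  rw [Polynomial.aeval_eq_sum_range, Polynomial.aeval_eq_sum_range, Finset.sum_mul, Finset.mul_sum]
  apply Finset.sum_congr rfl
  intro i _
  rw [smul_mul, hk, mul_smul_comm]

theorem aeval_diagonal {n : ℕ} (a : Fin n → ℂ) (F : Polynomial ℂ) :
    Polynomial.aeval (diagonal a) F = diagonal (fun i => F.eval (a i)) := by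
  rw [Polynomial.aeval_eq_sum_range]
  ext i j
  rw [Matrix.sum_apply]
  by_cases hij : i = j
  · subst hij
    simp [diagonal_pow, Polynomial.eval_eq_sum_range]
  · simp [diagonal_pow, hij]

theorem ncp_conj {M : Type*} [Monoid M] (P : M) (f g : ℕ → M) (h : ∀ l, f l * P = P * g l)
    (k : ℕ) : ncp f k * P = P * ncp g k := by
  induction k with
  | zero => simp [ncp]
  | succ k ih => rw [ncp, ncp, mul_assoc, h, ← mul_assoc, ih, mul_assoc]

theorem ncp_const {M : Type*} [Monoid M] (D : M) (k : ℕ) : ncp (fun _ => D) k = D ^ k := by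
  induction k with
  | zero => simp [ncp]
  | succ k ih => rw [ncp, ih, pow_succ]

theorem exists_interp {n : ℕ} (a : Fin n → ℂ) (ha : Function.Injective a) (q : Fin n → ℂ) :
    ∃ F : Polynomial ℂ, ∀ i, F.eval (a i) = q i :=
  ⟨Lagrange.interpolate Finset.univ a q, fun i =>
    Lagrange.eval_interpolate_at_node q ha.injOn (Finset.mem_univ i)⟩

/-- the matrix family used in the implicit function argument -/
def Kfam {n : ℕ} (m : ℕ) (a : Fin n → ℂ) (Z : Matrix (Fin n) (Fin n) ℂ) (c : ℕ → ℂ)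
    (x : (Fin n → ℂ) × ℂ) : Matrix (Fin n) (Fin n) ℂ :=
  ncp (fun l => diagonal x.1 + x.2 • (Z + algebraMap ℂ _ (c l))) m * diagonal (fun i => (a i)⁻¹)

theorem cd_mul {n : ℕ} {E : Type*} [NormedAddCommGroup E] [NormedSpace ℂ E]
    (f g : E → Matrix (Fin n) (Fin n) ℂ) (hf : ∀ i j, ContDiff ℂ 1 (fun x => f x i j))
    (hg : ∀ i j, ContDiff ℂ 1 (fun x => g x i j)) (i j : Fin n) :
    ContDiff ℂ 1 (fun x => (f x * g x) i j) := by
  simp only [mul_apply]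
  exact ContDiff.sum fun k _ => (hf i k).mul (hg k j)

theorem cd_det {n : ℕ} {E : Type*} [NormedAddCommGroup E] [NormedSpace ℂ E]
    (f : E → Matrix (Fin n) (Fin n) ℂ) (hf : ∀ i j, ContDiff ℂ 1 (fun x => f x i j)) :
    ContDiff ℂ 1 (fun x => (f x).det) := by
  simp only [det_apply]
  refine ContDiff.sum fun σ _ => ?_
  refine ContDiff.const_smul _ ?_
  exact contDiff_prod fun i _ => hf _ _

theorem cd_Kfam {n : ℕ} (m : ℕ) (a : Fin n → ℂ) (Z : Matrix (Fin n) (Fin n) ℂ) (c : ℕ → ℂ)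
    (i j : Fin n) : ContDiff ℂ 1 (fun x : (Fin n → ℂ) × ℂ => Kfam m a Z c x i j) := by
  unfold Kfam
  refine cd_mul (E := (Fin n → ℂ) × ℂ)
    (fun x => ncp (fun l => diagonal x.1 + x.2 • (Z + algebraMap ℂ _ (c l))) m)
    (fun _ => diagonal (fun i => (a i)⁻¹)) (fun i j => ?_) (fun i j => contDiff_const) i j
  have hl : ∀ l i j, ContDiff ℂ 1 (fun x : (Fin n → ℂ) × ℂ =>
      (diagonal x.1 + x.2 • (Z + algebraMap ℂ (Matrix (Fin n) (Fin n) ℂ) (c l))) i j) := by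
    intro l i j
    simp only [Matrix.add_apply, Matrix.smul_apply, smul_eq_mul]
    refine ContDiff.add ?_ (contDiff_snd.mul contDiff_const)
    by_cases hij : i = j
    · subst hij
      simp only [diagonal_apply_eq]
      exact (contDiff_apply ℂ ℂ i).comp contDiff_fst
    · simp only [diagonal_apply_ne _ hij]
      exact contDiff_const
  induction m generalizing i j with
  | zero => simp only [ncp]; exact contDiff_const
  | succ m ih =>
    simp only [ncp]
    exact cd_mul _ _ (fun i j => ih i j) (hl m) i j

theorem Kfam_zero {n : ℕ} (m : ℕ) (a : Fin n → ℂ) (Z : Matrix (Fin n) (Fin n) ℂ) (c : ℕ → ℂ)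
    (q : Fin n → ℂ) : Kfam m a Z c (q, 0) = diagonal (fun i => q i ^ m * (a i)⁻¹) := by
  unfold Kfam
  simp only [zero_smul, add_zero]
  rw [ncp_const, diagonal_pow, diagonal_mul_diagonal]
  rfl

theorem Kfam_det {n : ℕ} (m : ℕ) (a : Fin n → ℂ) (Z : Matrix (Fin n) (Fin n) ℂ) (c : ℕ → ℂ)
    (q : Fin n → ℂ) (z : ℂ) : (z • 1 - Kfam m a Z c (q, 0)).det = ∏ i, (z - q i ^ m * (a i)⁻¹) := by
  rw [Kfam_zero, smul_one_eq_diagonal, diagonal_sub, det_diagonal]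

open Topology in
theorem ift {n : ℕ} (m : ℕ) (hm : m ≠ 0) (a b : Fin n → ℂ) (Z : Matrix (Fin n) (Fin n) ℂ)
    (c : ℕ → ℂ) (ha0 : ∀ i, a i ≠ 0) (hb0 : ∀ i, b i ≠ 0) (hb : Function.Injective b) :
    ∀ᶠ e in 𝓝 (0 : ℂ), ∃ q : Fin n → ℂ, ∀ j, (b j • 1 - Kfam m a Z c (q, e)).det = 0 := by
  have hr : ∀ z : ℂ, ∃ y, y ^ m = z := fun z => IsAlgClosed.exists_pow_nat_eq z (Nat.pos_of_ne_zero hm)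
  choose ρ hρ using hr
  set q0 : Fin n → ℂ := fun i => ρ (a i * b i) with hq0
  have hq0m : ∀ i, q0 i ^ m * (a i)⁻¹ = b i := by
    intro i; rw [hq0]; simp only; rw [hρ]; field_simp [ha0 i]
  have hq00 : ∀ i, q0 i ≠ 0 := by
    intro i h
    have := hq0m i
    rw [h, zero_pow hm, zero_mul] at this
    exact hb0 i this.symm
  let F : (Fin n → ℂ) × ℂ → (Fin n → ℂ) := fun x j => (b j • 1 - Kfam m a Z c x).det
  let G : (Fin n → ℂ) × ℂ → (Fin n → ℂ) × ℂ := fun x => (F x, x.2)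
  have hF : ContDiff ℂ 1 F := by
    rw [contDiff_pi]
    intro j
    apply cd_det
    intro i k
    simp only [Matrix.sub_apply]
    exact contDiff_const.sub (cd_Kfam m a Z c i k)
  have hG : ContDiff ℂ 1 G := hF.prodMk contDiff_snd
  obtain ⟨G', hG'⟩ : ∃ G', HasStrictFDerivAt G G' (q0, 0) :=
    ⟨_, hG.contDiffAt.hasStrictFDerivAt (by simp)⟩
  have hG00 : G (q0, 0) = (0, 0) := by
    refine Prod.ext ?_ rfl
    ext j
    change (b j • 1 - Kfam m a Z c (q0, 0)).det = 0
    rw [Kfam_det]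
    exact Finset.prod_eq_zero (Finset.mem_univ j) (by rw [hq0m, sub_self])
  have hsnd : ∀ x, (G' x).2 = x.2 := by
    have h1 : HasFDerivAt (fun x => (G x).2) ((ContinuousLinearMap.snd ℂ _ _).comp G') (q0, 0) :=
      HasFDerivAt.comp (f := G) (q0, 0) (ContinuousLinearMap.snd ℂ (Fin n → ℂ) ℂ).hasFDerivAt hG'.hasFDerivAt
    have h2 : HasFDerivAt (fun x => (G x).2) (ContinuousLinearMap.snd ℂ (Fin n → ℂ) ℂ) (q0, 0) :=
      (ContinuousLinearMap.snd ℂ (Fin n → ℂ) ℂ).hasFDerivAt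
    intro x
    have := h1.unique h2
    exact congrArg (fun T => T x) this
  have hdir : ∀ k : Fin n, ∃ t : ℂ, t ≠ 0 ∧ G' (Pi.single k 1, 0) = (Pi.single k t, 0) := by
    intro k
    have hline : HasDerivAt (fun s : ℂ => ((q0 + s • Pi.single k 1 : Fin n → ℂ), (0 : ℂ))) (Pi.single k 1, 0) 0 := by
      refine HasDerivAt.prodMk ?_ (hasDerivAt_const _ _)
      have := ((hasDerivAt_id (0 : ℂ)).smul_const (Pi.single k 1 : Fin n → ℂ)).const_add q0
      simpa using this
    have hcomp : HasDerivAt (fun s : ℂ => G (q0 + s • Pi.single k 1, 0)) (G' (Pi.single k 1, 0)) 0 := by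
      have h0 : HasFDerivAt G G' ((fun s : ℂ => ((q0 + s • Pi.single k 1 : Fin n → ℂ), (0 : ℂ))) 0) := by
        simpa using hG'.hasFDerivAt
      exact HasFDerivAt.comp_hasDerivAt (f := fun s : ℂ => ((q0 + s • Pi.single k 1 : Fin n → ℂ), (0 : ℂ))) (0 : ℂ) h0 hline
    set C := ∏ i ∈ Finset.univ.erase k, (b k - b i) with hC
    have hC0 : C ≠ 0 := by
      rw [hC, Finset.prod_ne_zero_iff]
      intro i hi h
      exact (Finset.mem_erase.mp hi).1 (hb (sub_eq_zero.mp h).symm)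
    refine ⟨-(m * q0 k ^ (m - 1) * (a k)⁻¹) * C, ?_, ?_⟩
    · refine mul_ne_zero (neg_ne_zero.mpr (mul_ne_zero (mul_ne_zero ?_ (pow_ne_zero _ (hq00 k))) (inv_ne_zero (ha0 k)))) hC0
      exact_mod_cast hm
    · refine hcomp.unique (HasDerivAt.prodMk ?_ (hasDerivAt_const _ _))
      rw [hasDerivAt_pi]
      intro j
      have hval : (fun s : ℂ => F (q0 + s • Pi.single k 1, 0) j) = fun s : ℂ =>
          if j = k then (b k - (q0 k + s) ^ m * (a k)⁻¹) * C else 0 := by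
        ext s
        change (b j • 1 - Kfam m a Z c (q0 + s • Pi.single k 1, 0)).det = _
        rw [Kfam_det]
        split_ifs with hjk
        · subst hjk
          rw [← Finset.mul_prod_erase _ _ (Finset.mem_univ j)]
          congr 1
          · simp
          · apply Finset.prod_congr rfl
            intro i hi
            have : i ≠ j := (Finset.mem_erase.mp hi).1
            simp [this, hq0m]
        · apply Finset.prod_eq_zero (Finset.mem_univ j)
          simp [hjk, hq0m]
      rw [hval]
      by_cases hjk : j = k
      · subst hjk
        simp only [if_pos]
        rw [Pi.single_eq_same]
        have h1 := (hasDerivAt_id (0 : ℂ)).const_add (q0 j)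
        have h2 := (((h1.pow m).mul_const (a j)⁻¹).const_sub (b j)).mul_const C
        have h3 : -(↑m * (q0 j + id 0) ^ (m - 1) * 1 * (a j)⁻¹) * C =
            -(↑m * q0 j ^ (m - 1) * (a j)⁻¹) * C := by simp
        rw [h3] at h2
        exact h2
      · simp only [hjk, if_false]
        rw [Pi.single_eq_of_ne hjk]
        exact hasDerivAt_const _ _
  have hsurj : (G' : (Fin n → ℂ) × ℂ →ₗ[ℂ] (Fin n → ℂ) × ℂ).range = ⊤ := by
    rw [eq_top_iff]
    have hbase : ∀ y : Fin n → ℂ, (y, (0 : ℂ)) ∈ (G' : (Fin n → ℂ) × ℂ →ₗ[ℂ] (Fin n → ℂ) × ℂ).range := by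
      intro y
      choose t ht hGt using hdir
      refine ⟨∑ k, (y k * (t k)⁻¹) • (Pi.single k 1, 0), ?_⟩
      rw [map_sum]
      simp only [map_smul, ContinuousLinearMap.coe_coe, hGt]
      refine Prod.ext ?_ ?_
      · rw [Prod.fst_sum]
        ext j
        rw [Finset.sum_apply, Finset.sum_eq_single j]
        · simp [ht j]
        · intro i _ hij
          simp [Pi.single_eq_of_ne (Ne.symm hij)]
        · simp
      · rw [Prod.snd_sum]; simp
    rintro ⟨y, z⟩ -
    obtain ⟨x, hx⟩ := hbase (y - z • (G' (0, 1)).1)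
    refine ⟨x + z • (0, 1), ?_⟩
    rw [map_add, hx, map_smul]
    refine Prod.ext ?_ ?_
    · simp
    · have := hsnd (0, 1)
      simp [this]
  have hmap := hG'.map_nhds_eq_of_surj hsurj
  rw [hG00] at hmap
  have hev : ∀ᶠ y in 𝓝 ((0 : Fin n → ℂ), (0 : ℂ)), ∃ x, G x = y := by
    rw [← hmap, Filter.eventually_map]
    exact Filter.Eventually.of_forall fun x => ⟨x, rfl⟩
  have hcont : Filter.Tendsto (fun e : ℂ => ((0 : Fin n → ℂ), e)) (𝓝 0) (𝓝 (0, 0)) :=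
    (Continuous.prodMk continuous_const continuous_id).tendsto' _ _ rfl
  filter_upwards [hcont.eventually hev] with e he
  obtain ⟨⟨q, e'⟩, hx⟩ := he
  have h2 : e' = e := congrArg Prod.snd hx
  subst h2
  exact ⟨q, fun j => congrFun (congrArg Prod.fst hx) j⟩

open Topology in
theorem step3_matrix {n : ℕ} (m : ℕ) (hm : m ≠ 0) (A Z P : Matrix (Fin n) (Fin n) ℂ)
    (hP : IsUnit P) (a b : Fin n → ℂ) (hAP : A * P = P * diagonal a) (ha : Function.Injective a)
    (ha0 : ∀ i, a i ≠ 0) (hb0 : ∀ i, b i ≠ 0) (hb : Function.Injective b) (c : ℕ → ℂ) :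
    ∀ᶠ e in 𝓝[≠] (0 : ℂ), ∃ (F : Polynomial ℂ) (Q : Matrix (Fin n) (Fin n) ℂ), IsUnit Q ∧
      ncp (fun l => Z + Polynomial.aeval A F + algebraMap ℂ _ (c l)) m * A⁻¹ * Q =
        Q * diagonal (fun i => e⁻¹ ^ m * b i) := by
  have hPd := (isUnit_iff_isUnit_det P).mp hP
  set Z' := P⁻¹ * Z * P with hZ'
  have hPZ : P * Z' = Z * P := by
    rw [hZ', mul_assoc, mul_nonsing_inv_cancel_left _ _ hPd]
  have hev := ift m hm a b Z' c ha0 hb0 hb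
  rw [eventually_nhdsWithin_iff]
  filter_upwards [hev] with e he he0
  have he0 : e ≠ 0 := he0
  obtain ⟨q, hq⟩ := he
  obtain ⟨Q, hQ, hKQ⟩ := diag_of_roots _ b hb hq
  obtain ⟨F, hF⟩ := exists_interp a ha (fun i => e⁻¹ * q i)
  have hAd : IsUnit A.det := by
    have := congrArg Matrix.det hAP
    rw [det_mul, det_mul, det_diagonal, mul_comm] at this
    rw [mul_left_cancel₀ hPd.ne_zero this]
    exact isUnit_iff_ne_zero.mpr (Finset.prod_ne_zero_iff.mpr fun i _ => ha0 i)
  have hDD : diagonal a * diagonal (fun i => (a i)⁻¹) = 1 := by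
    rw [diagonal_mul_diagonal]
    simp [ha0]
  have hAi : A⁻¹ * P = P * diagonal (fun i => (a i)⁻¹) := by
    calc A⁻¹ * P = A⁻¹ * (P * diagonal a) * diagonal (fun i => (a i)⁻¹) := by
          rw [mul_assoc, mul_assoc, hDD, mul_one]
      _ = _ := by rw [← hAP, nonsing_inv_mul_cancel_left _ _ hAd]
  refine ⟨F, P * Q, hP.mul hQ, ?_⟩
  have h1 := ncp_conj P (fun l => Z + Polynomial.aeval A F + algebraMap ℂ (Matrix (Fin n) (Fin n) ℂ) (c l))
    (fun l => e⁻¹ • (diagonal q + e • (Z' + algebraMap ℂ _ (c l)))) (by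
      intro l
      rw [smul_add, smul_smul, inv_mul_cancel₀ he0, one_smul, add_mul, add_mul, aeval_conj A P _ hAP,
        aeval_diagonal, ← hPZ, Algebra.commutes, ← mul_add, ← mul_add]
      congr 1
      have : diagonal (fun i => Polynomial.eval (a i) F) = e⁻¹ • diagonal q := by
        rw [← diagonal_smul]; congr 1; ext i; exact hF i
      rw [this]; abel) m
  rw [ncp_smul] at h1
  calc ncp (fun l => Z + Polynomial.aeval A F + algebraMap ℂ _ (c l)) m * A⁻¹ * (P * Q)
      = ncp (fun l => Z + Polynomial.aeval A F + algebraMap ℂ _ (c l)) m * (A⁻¹ * P) * Q := by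
        simp only [mul_assoc]
    _ = (ncp (fun l => Z + Polynomial.aeval A F + algebraMap ℂ _ (c l)) m * P) * diagonal (fun i => (a i)⁻¹) * Q := by
        rw [hAi]; simp only [mul_assoc]
    _ = e⁻¹ ^ m • (P * (Kfam m a Z' c (q, e) * Q)) := by
        rw [h1, Kfam]; simp only [mul_assoc, mul_smul_comm, smul_mul]
    _ = _ := by
        rw [hKQ]
        have : diagonal (fun i => e⁻¹ ^ m * b i) = e⁻¹ ^ m • diagonal b := by
          rw [← diagonal_smul]; rfl
        rw [this, mul_smul_comm, mul_assoc]

/-! ### Data of constant dimension vector -/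

abbrev Mat (n : ℕ) := Matrix (Fin n) (Fin n) ℂ
abbrev Dat (n : ℕ) := Datum (fun _ : ℕ => n)

def yp {n : ℕ} (Y : ℕ → Mat n) : ℕ → Mat n
  | 0 => 1
  | k + 1 => Y k * yp Y k

def ys {n : ℕ} (Y : ℕ → Mat n) (i : ℕ) : ℕ → Mat n
  | 0 => 1
  | k + 1 => Y (i + k) * ys Y i k

def yc {n : ℕ} (p : ℕ) (Y : ℕ → Mat n) (i : ℕ) : Mat n :=
  if i ≤ p then ys Y (i + 1) (p - i) else 0

theorem yprod_eq {n : ℕ} (Y : ℕ → Mat n) (k : ℕ) :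
    yprod (α := fun _ : ℕ => n) Y k = yp Y k := by
  induction k with
  | zero => rfl
  | succ k ih => rw [yprod, yp, ih]

theorem yseg_eq {n : ℕ} (Y : ℕ → Mat n) (i k : ℕ) :
    ysegFrom (α := fun _ : ℕ => n) Y i k = ys Y i k := by
  induction k with
  | zero => rfl
  | succ k ih => rw [ysegFrom, ys, ih]

theorem ycap_eq {n : ℕ} (p : ℕ) (Y : ℕ → Mat n) (i : ℕ) :
    ycap (α := fun _ : ℕ => n) p rfl Y i = yc p Y i := by
  unfold ycap yc
  split
  · rw [yseg_eq]; rfl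
  · rfl

theorem Amat_eq {n : ℕ} (p : ℕ) (Y : ℕ → Mat n) :
    Amat (α := fun _ : ℕ => n) p rfl Y = yp Y (p + 1) := by
  unfold Amat
  rw [yprod_eq]; rfl

theorem recast_eq {n : ℕ} (M : Mat n) : recast (rfl : n = n) M = M := rfl

theorem ys_mul {n : ℕ} (Y : ℕ → Mat n) (i k : ℕ) : ys Y (i + 1) k * Y i = ys Y i (k + 1) := by
  induction k with
  | zero => simp [ys]
  | succ k ih =>
    rw [ys, mul_assoc, ih, show i + 1 + k = i + (k + 1) by ring]; rfl

theorem ys_yp {n : ℕ} (Y : ℕ → Mat n) (i k : ℕ) : ys Y i k * yp Y i = yp Y (i + k) := by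
  induction k with
  | zero => simp [ys]
  | succ k ih => rw [ys, mul_assoc, ih]; rfl

theorem yc_mul_yp {n : ℕ} (p : ℕ) (Y : ℕ → Mat n) (i : ℕ) (hi : i ≤ p) :
    yc p Y i * yp Y (i + 1) = yp Y (p + 1) := by
  rw [yc, if_pos hi, ys_yp]; congr 1; omega

theorem yc_succ {n : ℕ} (p : ℕ) (Y : ℕ → Mat n) (j : ℕ) (hj : j < p) :
    yc p Y (j + 1) * Y (j + 1) = yc p Y j := by
  rw [yc, yc, if_pos (by omega), if_pos (by omega), ys_mul]; congr 1; omega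

/-- the relations -/
def Rel {n : ℕ} (p : ℕ) (lam : ℕ → ℂ) (d : Dat n) : Prop :=
  (d.X 0 : Mat n) * d.Y 0 - (d.Y p : Mat n) * d.X p + vecMulVec d.v d.w = lam 0 • (1 : Mat n) ∧
    ∀ j : ℕ, j < p → (d.X (j + 1) : Mat n) * d.Y (j + 1) - (d.Y j : Mat n) * d.X j =
      lam (j + 1) • (1 : Mat n)

def Tail {n : ℕ} (p : ℕ) (d : Dat n) : Prop :=
  (∀ i : ℕ, p < i → d.X i = 0) ∧ ∀ i : ℕ, p < i → d.Y i = 0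

def Good {n : ℕ} (p : ℕ) (lam : ℕ → ℂ) (d : Dat n) : Prop := Rel p lam d ∧ Tail p d

theorem rel_of {n : ℕ} (p : ℕ) (lam : ℕ → ℂ) (d : Dat n)
    (h : IsRepDatum (α := fun _ : ℕ => n) p lam rfl d) : Rel p lam d := h

abbrev St (p n : ℕ) : Dat n → Dat n → Prop :=
  Step p (rfl : (fun _ : ℕ => n) (p + 1) = (fun _ : ℕ => n) 0)

abbrev Reach (p n : ℕ) : Dat n → Dat n → Prop := Relation.ReflTransGen (St p n)

/-- polynomial version of the transformations `Ψ` -/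
def psiP {n : ℕ} (p : ℕ) (f : Polynomial ℂ) (d : Dat n) : Dat n where
  X := fun i => (d.X i : Mat n) + yp d.Y i * Polynomial.aeval (yp d.Y (p + 1)) f * yc p d.Y i
  Y := d.Y
  v := d.v
  w := d.w

theorem psiP_monomial {n : ℕ} (p : ℕ) (k : ℕ) (μ : ℂ) (d : Dat n) :
    psiP p (Polynomial.monomial k μ) d = psiT p rfl (k + 1) μ d := by
  unfold psiP psiT
  congr 1
  ext1 i
  rw [yprod_eq, ycap_eq, Amat_eq]
  rw [Polynomial.aeval_monomial, ← Algebra.smul_def, mul_smul_comm, smul_mul, Nat.add_sub_cancel]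

theorem psiP_add {n : ℕ} (p : ℕ) (f g : Polynomial ℂ) (d : Dat n) :
    psiP p (f + g) d = psiP p g (psiP p f d) := by
  unfold psiP
  congr 1
  ext1 i
  simp only
  rw [map_add, mul_add, add_mul, add_assoc]

theorem psiP_reach {n : ℕ} (p : ℕ) (f : Polynomial ℂ) (d : Dat n) : Reach p n d (psiP p f d) := by
  induction f using Polynomial.induction_on' generalizing d with
  | add f g hf hg => rw [psiP_add]; exact (hf d).trans (hg _)
  | monomial k μ =>
    rw [psiP_monomial]
    exact Relation.ReflTransGen.single (Or.inl ⟨k + 1, μ, by omega, rfl⟩)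

theorem psiP_good {n : ℕ} (p : ℕ) (lam : ℕ → ℂ) (f : Polynomial ℂ) (d : Dat n)
    (h : Good p lam d) : Good p lam (psiP p f d) := by
  obtain ⟨⟨h0, hj⟩, hX, hY⟩ := h
  refine ⟨⟨?_, ?_⟩, ?_, hY⟩
  · rw [← h0]
    unfold psiP
    simp only
    have e1 : yc p d.Y 0 * d.Y 0 = yp d.Y (p + 1) := by
      have := yc_mul_yp p d.Y 0 (by omega)
      simpa [yp] using this
    have e2 : yc p d.Y p = 1 := by simp [yc, ys]
    have e3 : (d.Y p : Mat n) * yp d.Y p = yp d.Y (p + 1) := rfl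
    have e4 : Polynomial.aeval (yp d.Y (p + 1)) f * yp d.Y (p + 1) =
        yp d.Y (p + 1) * Polynomial.aeval (yp d.Y (p + 1)) f := by
      have := aeval_conj (yp d.Y (p + 1)) (yp d.Y (p + 1)) _ rfl f
      exact this
    have e5 : (d.X 0 + yp d.Y 0 * Polynomial.aeval (yp d.Y (p + 1)) f * yc p d.Y 0 : Mat n) * d.Y 0 =
        d.X 0 * d.Y 0 + yp d.Y (p + 1) * Polynomial.aeval (yp d.Y (p + 1)) f := by
      rw [add_mul, mul_assoc _ _ (d.Y 0), e1, mul_assoc, e4]; simp [yp]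
    have e6 : (d.Y p : Mat n) * (d.X p + yp d.Y p * Polynomial.aeval (yp d.Y (p + 1)) f * yc p d.Y p) =
        (d.Y p : Mat n) * d.X p + yp d.Y (p + 1) * Polynomial.aeval (yp d.Y (p + 1)) f := by
      rw [mul_add, e2, mul_one, ← mul_assoc _ (yp d.Y p), e3]
    refine congrArg (· + vecMulVec d.v d.w) ?_
    refine (congrArg₂ (· - ·) e5 e6).trans ?_
    abel
  · intro j hjp
    rw [← hj j hjp]
    have e3 : (d.Y j : Mat n) * yp d.Y j = yp d.Y (j + 1) := rfl
    have e4 := yc_succ p d.Y j hjp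
    set T := Polynomial.aeval (yp d.Y (p + 1)) f with hT
    have e5 : (d.X (j + 1) + yp d.Y (j + 1) * T * yc p d.Y (j + 1) : Mat n) * d.Y (j + 1) =
        d.X (j + 1) * d.Y (j + 1) + yp d.Y (j + 1) * T * yc p d.Y j := by
      rw [add_mul, mul_assoc _ _ (d.Y (j + 1)), e4]
    have e6 : (d.Y j : Mat n) * (d.X j + yp d.Y j * T * yc p d.Y j) =
        (d.Y j : Mat n) * d.X j + yp d.Y (j + 1) * T * yc p d.Y j := by
      rw [mul_add, ← e3]; simp only [mul_assoc]
    refine (congrArg₂ (· - ·) e5 e6).trans ?_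
    abel
  · intro i hi
    change (d.X i + yp d.Y i * _ * yc p d.Y i : Mat n) = 0
    rw [hX i hi, yc, if_neg (by omega), mul_zero, add_zero]

/-! ### Base change, symmetry, duality -/

theorem bcT_inv {n : ℕ} (p : ℕ) (g : ℕ → Mat n) (hg : ∀ i, IsUnit (g i)) (d : Dat n) :
    bcT (α := fun _ : ℕ => n) p (fun i => (g i)⁻¹) (bcT (α := fun _ : ℕ => n) p g d) = d := by
  have hd : ∀ i, IsUnit (g i).det := fun i => (isUnit_iff_isUnit_det _).mp (hg i)
  obtain ⟨X, Y, v, w⟩ := d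
  unfold bcT
  congr 1
  · ext1 i
    simp only
    split_ifs with hi
    · rw [nonsing_inv_nonsing_inv _ (hd (i + 1))]
      rw [mul_assoc, nonsing_inv_mul_cancel_right _ _ (hd (i + 1)),
        nonsing_inv_mul_cancel_left _ _ (hd i)]
    · rfl
  · ext1 i
    simp only
    split_ifs with hi
    · rw [nonsing_inv_nonsing_inv _ (hd i)]
      rw [mul_assoc, nonsing_inv_mul_cancel_right _ _ (hd i),
        nonsing_inv_mul_cancel_left _ _ (hd (i + 1))]
    · rfl
  · simp only
    rw [mulVec_mulVec, nonsing_inv_mul _ (hd 0), one_mulVec]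
  · simp only
    rw [nonsing_inv_nonsing_inv _ (hd 0), vecMul_vecMul, nonsing_inv_mul _ (hd 0), vecMul_one]

def dual {n : ℕ} (d : Dat n) : Dat n where
  X := fun i => (d.Y i : Mat n)ᵀ
  Y := fun i => (d.X i : Mat n)ᵀ
  v := d.w
  w := d.v

theorem dual_dual {n : ℕ} (d : Dat n) : dual (dual d) = d := rfl

theorem xprod_dual {n : ℕ} (X : ℕ → Mat n) (k : ℕ) :
    xprod (α := fun _ : ℕ => n) X k = (yp (fun i => (X i)ᵀ) k)ᵀ := by
  induction k with
  | zero => simp [xprod, yp]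
  | succ k ih => rw [xprod, yp, ih]; simp

theorem xseg_dual {n : ℕ} (X : ℕ → Mat n) (i k : ℕ) :
    xsegFrom (α := fun _ : ℕ => n) X i k = (ys (fun i => (X i)ᵀ) i k)ᵀ := by
  induction k with
  | zero => simp [xsegFrom, ys]
  | succ k ih => rw [xsegFrom, ys, ih]; simp

theorem xcap_dual {n : ℕ} (p : ℕ) (X : ℕ → Mat n) (i : ℕ) :
    xcap (α := fun _ : ℕ => n) p rfl X i = (yc p (fun i => (X i)ᵀ) i)ᵀ := by
  unfold xcap yc
  split
  · rw [xseg_dual]; rfl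
  · simp

theorem Bmat_dual {n : ℕ} (p : ℕ) (X : ℕ → Mat n) :
    Bmat (α := fun _ : ℕ => n) p rfl X = (yp (fun i => (X i)ᵀ) (p + 1))ᵀ := by
  unfold Bmat
  rw [xprod_dual]; rfl

theorem phiT_dual {n : ℕ} (p k : ℕ) (ν : ℂ) (d : Dat n) :
    phiT p rfl k ν d = dual (psiT p rfl k ν (dual d)) := by
  obtain ⟨X, Y, v, w⟩ := d
  unfold phiT psiT dual
  congr 1
  ext1 i
  simp only
  rw [xprod_dual, xcap_dual, Bmat_dual, yprod_eq, ycap_eq, Amat_eq]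
  rw [transpose_add, transpose_smul, transpose_mul, transpose_mul, transpose_pow]
  rw [transpose_transpose, mul_assoc]

theorem psiT_neg {n : ℕ} (p k : ℕ) (ν : ℂ) (d : Dat n) :
    psiT p rfl k (-ν) (psiT p rfl k ν d) = d := by
  obtain ⟨X, Y, v, w⟩ := d
  unfold psiT
  congr 1
  ext1 i
  simp only
  rw [neg_smul, add_neg_cancel_right]

theorem st_symm {n p : ℕ} {d d' : Dat n} (h : St p n d d') : St p n d' d := by
  rcases h with ⟨k, μ, hk, rfl⟩ | ⟨k, μ, hk, rfl⟩ | ⟨g, hg, hg0, rfl⟩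
  · exact Or.inl ⟨k, -μ, hk, (psiT_neg p k μ d).symm⟩
  · refine Or.inr (Or.inl ⟨k, -μ, hk, ?_⟩)
    rw [phiT_dual, phiT_dual, dual_dual, psiT_neg, dual_dual]
  · refine Or.inr (Or.inr ⟨fun i => (g i)⁻¹, fun i => ?_, ?_, (bcT_inv p g hg d).symm⟩)
    · exact (Matrix.isUnit_nonsing_inv_iff).mpr (hg i)
    · simp only
      rw [hg0]; rfl

theorem reach_symm {n p : ℕ} {d d' : Dat n} (h : Reach p n d d') : Reach p n d' d := by
  induction h with
  | refl => exact Relation.ReflTransGen.refl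
  | tail _ h2 ih => exact Relation.ReflTransGen.head (st_symm h2) ih

theorem bcT_dual {n : ℕ} (p : ℕ) (g : ℕ → Mat n) (hg : ∀ i, IsUnit (g i)) (d : Dat n) :
    dual (bcT (α := fun _ : ℕ => n) p g d) =
      bcT (α := fun _ : ℕ => n) p (fun i => ((g i)⁻¹)ᵀ) (dual d) := by
  have hd : ∀ i, IsUnit (g i).det := fun i => (isUnit_iff_isUnit_det _).mp (hg i)
  have hi : ∀ i, (((g i)⁻¹)ᵀ)⁻¹ = (g i)ᵀ := fun i => by
    rw [transpose_nonsing_inv, nonsing_inv_nonsing_inv]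
    rw [det_transpose]; exact hd i
  obtain ⟨X, Y, v, w⟩ := d
  unfold bcT dual
  congr 1
  · ext1 i
    simp only
    split_ifs
    · rw [hi, transpose_mul, transpose_mul, mul_assoc]
    · rfl
  · ext1 i
    simp only
    split_ifs
    · rw [hi, transpose_mul, transpose_mul, mul_assoc]
    · rfl
  · simp only
    rw [mulVec_transpose]
  · simp only
    rw [hi, vecMul_transpose]

theorem st_dual {n p : ℕ} {d d' : Dat n} (h : St p n d d') : St p n (dual d) (dual d') := by
  rcases h with ⟨k, μ, hk, rfl⟩ | ⟨k, μ, hk, rfl⟩ | ⟨g, hg, hg0, rfl⟩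
  · refine Or.inr (Or.inl ⟨k, μ, hk, ?_⟩)
    rw [phiT_dual, dual_dual]
  · refine Or.inl ⟨k, μ, hk, ?_⟩
    rw [phiT_dual, dual_dual]
  · refine Or.inr (Or.inr ⟨fun i => ((g i)⁻¹)ᵀ, fun i => ?_, ?_, bcT_dual p g hg d⟩)
    · rw [Matrix.isUnit_transpose]
      exact (Matrix.isUnit_nonsing_inv_iff).mpr (hg i)
    · simp only
      rw [hg0]; rfl

theorem reach_dual {n p : ℕ} {d d' : Dat n} (h : Reach p n d d') :
    Reach p n (dual d) (dual d') :=
  Relation.ReflTransGen.lift dual (fun _ _ => st_dual) _ _ h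

theorem good_dual {n p : ℕ} {lam : ℕ → ℂ} {d : Dat n} (h : Good p lam d) : Good p lam (dual d) := by
  obtain ⟨⟨h0, hj⟩, hX, hY⟩ := h
  refine ⟨⟨?_, ?_⟩, ?_, ?_⟩
  · have := congrArg Matrix.transpose h0
    rw [transpose_add, transpose_sub, transpose_mul, transpose_mul, transpose_smul, transpose_one,
      transpose_vecMulVec] at this
    exact this
  · intro j hjp
    have := congrArg Matrix.transpose (hj j hjp)
    rw [transpose_sub, transpose_mul, transpose_mul, transpose_smul, transpose_one] at this
    exact this
  · intro i hi
    change (d.Y i : Mat n)ᵀ = 0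
    rw [hY i hi]; exact transpose_zero
  · intro i hi
    change (d.X i : Mat n)ᵀ = 0
    rw [hX i hi]; exact transpose_zero


/-! ### Identities for a datum, and steps 2, 3, 4 -/

def cc (lam : ℕ → ℂ) (k : ℕ) : ℂ := ∑ t ∈ Finset.range k, lam (t + 1)

def ZZ {n : ℕ} (d : Dat n) : Mat n := (d.X 0 : Mat n) * (d.Y 0 : Mat n)

def AA {n : ℕ} (p : ℕ) (d : Dat n) : Mat n := yp d.Y (p + 1)

def BB {n : ℕ} (p : ℕ) (d : Dat n) : Mat n := ncp (M := Mat n) d.X (p + 1)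

theorem xy_yp {n p : ℕ} {lam : ℕ → ℂ} {d : Dat n} (h : Good p lam d) (k : ℕ) (hk : k ≤ p) :
    (d.X k : Mat n) * yp d.Y (k + 1) = yp d.Y k * (ZZ d + algebraMap ℂ (Mat n) (cc lam k)) := by
  induction k with
  | zero => simp [yp, ZZ, cc]
  | succ k ih =>
    have ih := ih (by omega)
    have h2 := h.1.2 k (by omega)
    have h3 : (d.X (k + 1) : Mat n) * (d.Y (k + 1) : Mat n) =
        (d.Y k : Mat n) * (d.X k : Mat n) + lam (k + 1) • (1 : Mat n) := by
      rw [← h2]; abel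
    have e1 : yp d.Y (k + 1 + 1) = (d.Y (k + 1) : Mat n) * yp d.Y (k + 1) := rfl
    have e2 : yp d.Y (k + 1) = (d.Y k : Mat n) * yp d.Y k := rfl
    have e3 : cc lam (k + 1) = cc lam k + lam (k + 1) := by
      unfold cc; rw [Finset.sum_range_succ]
    rw [e1, ← mul_assoc]
    refine (congrArg (· * yp d.Y (k + 1)) h3).trans ?_
    rw [add_mul, mul_assoc, ih, ← mul_assoc, ← e2, e3, map_add, ← add_assoc, mul_add _ (_ + _),
      smul_mul_assoc, one_mul, ← Algebra.commutes (lam (k + 1)), ← Algebra.smul_def]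

theorem xp_yp {n p : ℕ} {lam : ℕ → ℂ} {d : Dat n} (h : Good p lam d) (k : ℕ) (hk : k ≤ p + 1) :
    ncp (M := Mat n) d.X k * yp d.Y k =
      ncp (fun l => ZZ d + algebraMap ℂ (Mat n) (cc lam l)) k := by
  induction k with
  | zero => simp [yp, ncp]
  | succ k ih =>
    rw [ncp, ncp, mul_assoc, ← ih (by omega), mul_assoc]
    exact congrArg _ (xy_yp h k (by omega))

theorem zrel {n p : ℕ} {lam : ℕ → ℂ} {d : Dat n} (h : Good p lam d) :
    ZZ d * AA p d - AA p d * ZZ d =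
      (∑ t ∈ Finset.range (p + 1), lam t) • AA p d - vecMulVec d.v d.w * AA p d := by
  have h1 := xy_yp h p le_rfl
  have h0 := h.1.1
  have e2 : AA p d = (d.Y p : Mat n) * yp d.Y p := rfl
  have h2 : (d.Y p : Mat n) * (d.X p : Mat n) * AA p d =
      AA p d * (ZZ d + algebraMap ℂ (Mat n) (cc lam p)) := by
    rw [mul_assoc]
    refine (congrArg (fun x : Mat n => (d.Y p : Mat n) * x) h1).trans ?_
    rw [← mul_assoc, ← e2]
  have h3 := congrArg (fun x : Mat n => x * AA p d) h0
  simp only [add_mul, sub_mul, smul_mul_assoc, one_mul] at h3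
  have h4 : (d.X 0 : Mat n) * (d.Y 0 : Mat n) = ZZ d := rfl
  have h5 : ZZ d * AA p d - AA p d * (ZZ d + algebraMap ℂ (Mat n) (cc lam p)) +
      vecMulVec d.v d.w * AA p d = lam 0 • AA p d := by
    rw [← h2, ← h3]; rfl
  rw [Finset.sum_range_succ', add_smul, ← h5, mul_add, ← Algebra.commutes (cc lam p),
    ← Algebra.smul_def]
  unfold cc
  abel

theorem psiP_Z {n p : ℕ} (f : Polynomial ℂ) (d : Dat n) :
    ZZ (psiP p f d) = ZZ d + Polynomial.aeval (AA p d) f * AA p d := by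
  have e1 : yc p d.Y 0 * d.Y 0 = yp d.Y (p + 1) := by
    have := yc_mul_yp p d.Y 0 (by omega)
    simpa [yp] using this
  have : ZZ (psiP p f d) =
    ((d.X 0 : Mat n) + yp d.Y 0 * Polynomial.aeval (yp d.Y (p + 1)) f * yc p d.Y 0) * d.Y 0 := rfl
  rw [this, add_mul, mul_assoc _ _ (d.Y 0), e1, mul_assoc]
  simp [yp, ZZ, AA]

theorem psiP_A {n p : ℕ} (f : Polynomial ℂ) (d : Dat n) : AA p (psiP p f d) = AA p d := rfl

theorem inv_poly {n : ℕ} (A : Mat n) (hA : IsUnit A) (F : Polynomial ℂ) :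
    ∃ f : Polynomial ℂ, Polynomial.aeval A f * A = Polynomial.aeval A F := by
  have hdet : A.det ≠ 0 := ((isUnit_iff_isUnit_det _).mp hA).ne_zero
  have h0 : A.charpoly.coeff 0 ≠ 0 := by
    intro h
    apply hdet
    rw [det_eq_sign_charpoly_coeff, h, mul_zero]
  have h1 := A.aeval_self_charpoly
  rw [← Polynomial.divX_mul_X_add A.charpoly] at h1
  simp only [map_add, map_mul, Polynomial.aeval_X, Polynomial.aeval_C] at h1
  have h2 := eq_neg_of_add_eq_zero_left h1
  refine ⟨F * (Polynomial.C (-(A.charpoly.coeff 0)⁻¹) * A.charpoly.divX), ?_⟩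
  rw [map_mul, map_mul, Polynomial.aeval_C, mul_assoc, mul_assoc, h2, ← map_neg, ← map_mul]
  rw [neg_mul_neg, inv_mul_cancel₀ h0, map_one, mul_one]

theorem B_eq {n p : ℕ} {lam : ℕ → ℂ} {d : Dat n} (h : Good p lam d) (hA : IsUnit (AA p d)) :
    BB p d = ncp (fun l => ZZ d + algebraMap ℂ (Mat n) (cc lam l)) (p + 1) * (AA p d)⁻¹ := by
  rw [← xp_yp h (p + 1) le_rfl]
  exact (mul_nonsing_inv_cancel_right _ _ ((isUnit_iff_isUnit_det _).mp hA)).symm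

theorem step2 {n p : ℕ} {lam : ℕ → ℂ} (hκ : (∑ t ∈ Finset.range (p + 1), lam t) ≠ 0)
    {d : Dat n} (h : Good p lam d) (hA : IsUnit (AA p d)) :
    ∃ d', Reach p n d d' ∧ Good p lam d' ∧ ∃ P b, IsUnit P ∧ Function.Injective b ∧
      (∀ i, b i ≠ 0) ∧ BB p d' * P = P * diagonal b := by
  obtain ⟨F, P, b, hP, hb, hb0, e⟩ := step2_matrix (p + 1) (by omega) (AA p d) (ZZ d) hA _ hκ
    d.v d.w (zrel h) (cc lam)
  obtain ⟨f, hf⟩ := inv_poly _ hA F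
  refine ⟨psiP p f d, psiP_reach p f d, psiP_good p lam f d h, P, b, hP, hb, hb0, ?_⟩
  rw [B_eq (psiP_good p lam f d h) hA, psiP_Z, hf, psiP_A, e]

theorem unit_of_diag {n : ℕ} {A P : Mat n} {a : Fin n → ℂ} (hP : IsUnit P)
    (h : A * P = P * diagonal a) (ha0 : ∀ i, a i ≠ 0) : IsUnit A := by
  have h1 : IsUnit (diagonal a) := by
    rw [isUnit_iff_isUnit_det, det_diagonal, isUnit_iff_ne_zero]
    exact Finset.prod_ne_zero_iff.mpr fun i _ => ha0 i
  have h2 : IsUnit (A * P) := h ▸ hP.mul h1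
  rw [isUnit_iff_isUnit_det] at h2 ⊢
  rw [det_mul] at h2
  exact isUnit_of_mul_isUnit_left h2

theorem step3 {n p : ℕ} {lam : ℕ → ℂ} {d : Dat n} (h : Good p lam d) (P : Mat n) (hP : IsUnit P)
    (a b : Fin n → ℂ) (hAP : AA p d * P = P * diagonal a) (ha : Function.Injective a)
    (ha0 : ∀ i, a i ≠ 0) (hb0 : ∀ i, b i ≠ 0) (hb : Function.Injective b) :
    ∀ᶠ e in nhdsWithin (0 : ℂ) {0}ᶜ, ∃ d', Reach p n d d' ∧ Good p lam d' ∧ ∃ Q, IsUnit Q ∧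
      BB p d' * Q = Q * diagonal (fun i => e⁻¹ ^ (p + 1) * b i) := by
  have hA := unit_of_diag hP hAP ha0
  filter_upwards [step3_matrix (p + 1) (by omega) (AA p d) (ZZ d) P hP a b hAP ha ha0 hb0 hb
    (cc lam)] with e he
  obtain ⟨F, Q, hQ, e⟩ := he
  obtain ⟨f, hf⟩ := inv_poly _ hA F
  refine ⟨psiP p f d, psiP_reach p f d, psiP_good p lam f d h, Q, hQ, ?_⟩
  rw [B_eq (psiP_good p lam f d h) hA, psiP_Z, hf, psiP_A, e]

/-! ### Step 4: normal form -/

theorem bcT_good {n p : ℕ} {lam : ℕ → ℂ} {d : Dat n} (h : Good p lam d) (g : ℕ → Mat n)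
    (hg : ∀ i, IsUnit (g i)) (hg0 : g (p + 1) = g 0) :
    Good p lam (bcT (α := fun _ : ℕ => n) p g d) := by
  have hd : ∀ i, IsUnit (g i).det := fun i => (isUnit_iff_isUnit_det _).mp (hg i)
  obtain ⟨⟨h0, hj⟩, hX, hY⟩ := h
  have eX : ∀ i, i ≤ p → (bcT (α := fun _ : ℕ => n) p g d).X i =
      g i * (d.X i : Mat n) * (g (i + 1))⁻¹ := fun i hi => if_pos hi
  have eY : ∀ i, i ≤ p → (bcT (α := fun _ : ℕ => n) p g d).Y i =
      g (i + 1) * (d.Y i : Mat n) * (g i)⁻¹ := fun i hi => if_pos hi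
  have eXY : ∀ i (hi : i ≤ p), ((bcT (α := fun _ : ℕ => n) p g d).X i : Mat n) *
      ((bcT (α := fun _ : ℕ => n) p g d).Y i : Mat n) =
      g i * ((d.X i : Mat n) * (d.Y i : Mat n)) * (g i)⁻¹ := fun i hi => by
    refine (congrArg₂ (fun x y : Mat n => x * y) (eX i hi) (eY i hi)).trans ?_
    simp only [mul_assoc]
    rw [nonsing_inv_mul_cancel_left _ _ (hd (i + 1))]
  have eYX : ∀ i (hi : i ≤ p), ((bcT (α := fun _ : ℕ => n) p g d).Y i : Mat n) *
      ((bcT (α := fun _ : ℕ => n) p g d).X i : Mat n) =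
      g (i + 1) * ((d.Y i : Mat n) * (d.X i : Mat n)) * (g (i + 1))⁻¹ := fun i hi => by
    refine (congrArg₂ (fun x y : Mat n => x * y) (eY i hi) (eX i hi)).trans ?_
    simp only [mul_assoc]
    rw [nonsing_inv_mul_cancel_left _ _ (hd i)]
  refine ⟨⟨?_, ?_⟩, ?_, ?_⟩
  · have e3 : vecMulVec (bcT (α := fun _ : ℕ => n) p g d).v (bcT (α := fun _ : ℕ => n) p g d).w =
        g 0 * vecMulVec d.v d.w * (g 0)⁻¹ := by
      rw [mul_vecMulVec, vecMulVec_mul]; rfl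
    refine (congrArg₂ (fun x y : Mat n => x + y) (congrArg₂ (fun x y : Mat n => x - y)
      (eXY 0 (by omega)) (eYX p le_rfl)) e3).trans ?_
    rw [hg0, ← sub_mul, ← mul_sub, ← add_mul, ← mul_add]
    refine (congrArg (fun x : Mat n => g 0 * x * (g 0)⁻¹) h0).trans ?_
    rw [mul_smul_comm, mul_one, smul_mul_assoc, mul_nonsing_inv _ (hd 0)]
  · intro j hjp
    refine (congrArg₂ (fun x y : Mat n => x - y)
      (eXY (j + 1) (by omega)) (eYX j (by omega))).trans ?_
    rw [← sub_mul, ← mul_sub]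
    refine (congrArg (fun x : Mat n => g (j + 1) * x * (g (j + 1))⁻¹) (hj j hjp)).trans ?_
    rw [mul_smul_comm, mul_one, smul_mul_assoc, mul_nonsing_inv _ (hd (j + 1))]
  · intro i hi
    exact (if_neg (by omega)).trans (hX i hi)
  · intro i hi
    exact (if_neg (by omega)).trans (hY i hi)

theorem diag_vw {n : ℕ} (Z : Mat n) (a v w : Fin n → ℂ) (ha0 : ∀ i, a i ≠ 0) (κ : ℂ)
    (h : Z * diagonal a - diagonal a * Z = κ • diagonal a - vecMulVec v w * diagonal a)
    (i : Fin n) : v i * w i = κ := by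
  have := congrFun (congrFun h i) i
  simp only [Matrix.sub_apply, mul_diagonal, diagonal_mul, Matrix.smul_apply, diagonal_apply_eq,
    vecMulVec_apply, smul_eq_mul] at this
  have h2 : (v i * w i - κ) * a i = 0 := by linear_combination this
  rcases mul_eq_zero.mp h2 with h3 | h3
  · exact sub_eq_zero.mp h3
  · exact absurd h3 (ha0 i)

def Ynf {n : ℕ} (p : ℕ) (a : Fin n → ℂ) (i : ℕ) : Mat n :=
  if i < p then 1 else if i = p then diagonal a else 0

theorem yp_nf {n p : ℕ} (a : Fin n → ℂ) (k : ℕ) (hk : k ≤ p) : yp (Ynf p a) k = 1 := by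
  induction k with
  | zero => rfl
  | succ k ih => rw [yp, ih (by omega), Ynf, if_pos (by omega), one_mul]

theorem A_nf {n p : ℕ} (a : Fin n → ℂ) : yp (Ynf p a) (p + 1) = diagonal a := by
  rw [yp, yp_nf a p le_rfl, Ynf, if_neg (by omega), if_pos rfl, mul_one]

theorem yp_unit {n p : ℕ} {d : Dat n} (hA : IsUnit (AA p d)) (i : ℕ) (hi : i ≤ p + 1) :
    IsUnit (yp d.Y i) := by
  cases i with
  | zero => exact isUnit_one
  | succ i =>
    have e := yc_mul_yp p d.Y i (by omega)
    have h2 : IsUnit (yc p d.Y i * yp d.Y (i + 1)) := by rw [e]; exact hA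
    rw [isUnit_iff_isUnit_det] at h2 ⊢
    rw [det_mul] at h2
    exact isUnit_of_mul_isUnit_right h2

theorem normal_form {n p : ℕ} {lam : ℕ → ℂ} (hκ : (∑ t ∈ Finset.range (p + 1), lam t) ≠ 0)
    {d : Dat n} (h : Good p lam d) (P : Mat n) (hP : IsUnit P) (a : Fin n → ℂ)
    (hAP : AA p d * P = P * diagonal a) (ha0 : ∀ i, a i ≠ 0) :
    ∃ d', Reach p n d d' ∧ Good p lam d' ∧ d'.Y = Ynf p a ∧ d'.v = (fun _ => 1) ∧
      d'.w = fun _ => ∑ t ∈ Finset.range (p + 1), lam t := by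
  have hA := unit_of_diag hP hAP ha0
  have hPd : IsUnit P.det := (isUnit_iff_isUnit_det _).mp hP
  have hz := zrel h
  have hAD : P⁻¹ * AA p d = diagonal a * P⁻¹ := by
    have := congrArg (fun x : Mat n => P⁻¹ * x * P⁻¹) hAP
    rw [← mul_assoc, mul_nonsing_inv_cancel_right _ _ hPd, ← mul_assoc, nonsing_inv_mul _ hPd,
      one_mul] at this
    exact this
  have hV : ∀ i, (P⁻¹ *ᵥ d.v) i * (d.w ᵥ* P) i = ∑ t ∈ Finset.range (p + 1), lam t := by
    apply diag_vw (P⁻¹ * ZZ d * P) a _ _ ha0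
    have h1 := congrArg (fun x : Mat n => P⁻¹ * x * P) hz
    simp only [mul_sub, sub_mul, mul_smul_comm, smul_mul_assoc] at h1
    have e1 : P⁻¹ * (ZZ d * AA p d) * P = P⁻¹ * ZZ d * P * diagonal a := by
      simp only [mul_assoc]; rw [hAP]
    have e2 : P⁻¹ * (AA p d * ZZ d) * P = diagonal a * (P⁻¹ * ZZ d * P) := by
      rw [← mul_assoc, hAD]; simp only [mul_assoc]
    have e3 : P⁻¹ * AA p d * P = diagonal a := by
      rw [hAD, nonsing_inv_mul_cancel_right _ _ hPd]
    have e4 : P⁻¹ * (vecMulVec d.v d.w * AA p d) * P =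
        vecMulVec (P⁻¹ *ᵥ d.v) (d.w ᵥ* P) * diagonal a := by
      rw [← mul_vecMulVec, ← vecMulVec_mul]
      simp only [mul_assoc]; rw [hAP]
    rw [e1, e2, e3, e4] at h1
    exact h1
  have hV0 : ∀ i, (P⁻¹ *ᵥ d.v) i ≠ 0 := fun i h0 => hκ (by rw [← hV i, h0, zero_mul])
  let g0 : Mat n := diagonal (fun i => ((P⁻¹ *ᵥ d.v) i)⁻¹) * P⁻¹
  have hg0 : IsUnit g0 := by
    refine IsUnit.mul ?_ (Matrix.isUnit_nonsing_inv_iff.mpr hP)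
    rw [isUnit_iff_isUnit_det, det_diagonal, isUnit_iff_ne_zero]
    exact Finset.prod_ne_zero_iff.mpr fun i _ => inv_ne_zero (hV0 i)
  have hg0d : IsUnit g0.det := (isUnit_iff_isUnit_det _).mp hg0
  have hg0v : g0 *ᵥ d.v = fun _ => 1 := by
    rw [← mulVec_mulVec]
    ext i
    rw [mulVec_diagonal, inv_mul_cancel₀ (hV0 i)]
  have hg0A : g0 * AA p d * g0⁻¹ = diagonal a := by
    have : g0 * AA p d = diagonal a * g0 := by
      change diagonal _ * P⁻¹ * AA p d = diagonal a * (diagonal _ * P⁻¹)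
      rw [mul_assoc, hAD, ← mul_assoc, ← mul_assoc, diagonal_mul_diagonal, diagonal_mul_diagonal]
      simp only [mul_comm]
    rw [this, mul_nonsing_inv_cancel_right _ _ hg0d]
  let g : ℕ → Mat n := fun i => if i ≤ p then g0 * (yp d.Y i)⁻¹ else g0
  have hg : ∀ i, IsUnit (g i) := fun i => by
    by_cases hi : i ≤ p
    · have : g i = g0 * (yp d.Y i)⁻¹ := if_pos hi
      rw [this]
      exact hg0.mul (Matrix.isUnit_nonsing_inv_iff.mpr (yp_unit hA i (by omega)))
    · have : g i = g0 := if_neg hi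
      rw [this]; exact hg0
  have hgz : g 0 = g0 := by simp [g, yp]
  have hgp : g (p + 1) = g 0 := by rw [hgz]; simp [g]
  have hginv : ∀ i, i ≤ p → (g i)⁻¹ = yp d.Y i * g0⁻¹ := fun i hi => by
    have : g i = g0 * (yp d.Y i)⁻¹ := if_pos hi
    rw [this, Matrix.mul_inv_rev, nonsing_inv_nonsing_inv]
    exact (isUnit_iff_isUnit_det _).mp (yp_unit hA i (by omega))
  have hgood := bcT_good h g hg hgp
  set d' := bcT (α := fun _ : ℕ => n) p g d with hd'
  have hY' : d'.Y = Ynf p a := by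
    ext1 i
    by_cases hi : i ≤ p
    · have e1 : (d'.Y i : Mat n) = g (i + 1) * (d.Y i : Mat n) * (g i)⁻¹ := if_pos hi
      have e2 : (d'.Y i : Mat n) = g (i + 1) * yp d.Y (i + 1) * g0⁻¹ := by
        rw [e1, hginv i hi, show yp d.Y (i + 1) = (d.Y i : Mat n) * yp d.Y i from rfl]
        simp only [mul_assoc]
      by_cases hi2 : i < p
      · have e3 : g (i + 1) = g0 * (yp d.Y (i + 1))⁻¹ := if_pos (by omega)
        rw [Ynf, if_pos hi2]
        refine e2.trans ?_
        rw [e3, nonsing_inv_mul_cancel_right _ _ ((isUnit_iff_isUnit_det _).mp (yp_unit hA _ (by omega))),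
          mul_nonsing_inv _ hg0d]
      · obtain rfl : i = p := by omega
        rw [Ynf, if_neg hi2, if_pos rfl]
        refine e2.trans ?_
        rw [hgp, hgz]
        exact hg0A
    · rw [Ynf, if_neg (by omega), if_neg (by omega)]
      exact hgood.2.2 i (by omega)
  have hv' : d'.v = fun _ => 1 := by
    change g 0 *ᵥ d.v = _
    rw [hgz, hg0v]
  refine ⟨d', Relation.ReflTransGen.single (Or.inr (Or.inr ⟨g, hg, hgp, rfl⟩)), hgood, hY', hv', ?_⟩
  ext1 i
  have hA' : AA p d' = diagonal a := by rw [AA, hY', A_nf]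
  have hz' := zrel hgood
  rw [hA'] at hz'
  have := diag_vw _ a d'.v d'.w ha0 _ hz' i
  rw [hv', one_mul] at this
  exact this

theorem step4 {n p : ℕ} {lam : ℕ → ℂ} (hκ : (∑ t ∈ Finset.range (p + 1), lam t) ≠ 0)
    {d₁ d₂ : Dat n} (h₁ : Good p lam d₁) (h₂ : Good p lam d₂) (P₁ P₂ : Mat n) (hP₁ : IsUnit P₁)
    (hP₂ : IsUnit P₂) (a : Fin n → ℂ) (hAP₁ : AA p d₁ * P₁ = P₁ * diagonal a)
    (hAP₂ : AA p d₂ * P₂ = P₂ * diagonal a) (ha0 : ∀ i, a i ≠ 0) (ha : Function.Injective a) :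
    Reach p n d₁ d₂ := by
  obtain ⟨e₁, r₁, g₁, hY₁, hv₁, hw₁⟩ := normal_form hκ h₁ P₁ hP₁ a hAP₁ ha0
  obtain ⟨e₂, r₂, g₂, hY₂, hv₂, hw₂⟩ := normal_form hκ h₂ P₂ hP₂ a hAP₂ ha0
  have hA₁ : AA p e₁ = diagonal a := by rw [AA, hY₁, A_nf]
  have hA₂ : AA p e₂ = diagonal a := by rw [AA, hY₂, A_nf]
  have hz : (ZZ e₂ - ZZ e₁) * diagonal a = diagonal a * (ZZ e₂ - ZZ e₁) := by
    have z₁ := zrel g₁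
    have z₂ := zrel g₂
    rw [hA₁, hv₁, hw₁] at z₁
    rw [hA₂, hv₂, hw₂, ← z₁] at z₂
    rw [sub_mul, mul_sub]
    have := sub_eq_zero.mpr z₂
    rw [← sub_eq_zero, ← this]; abel
  obtain ⟨f, hf⟩ := exists_interp a ha (fun i => (ZZ e₂ - ZZ e₁) i i * (a i)⁻¹)
  have hZ : ZZ (psiP p f e₁) = ZZ e₂ := by
    rw [psiP_Z, hA₁, aeval_diagonal, diagonal_mul_diagonal]
    have : ZZ e₂ - ZZ e₁ = diagonal (fun i => f.eval (a i) * a i) := by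
      ext i j
      by_cases hij : i = j
      · subst hij
        rw [diagonal_apply_eq, hf, mul_assoc, inv_mul_cancel₀ (ha0 i), mul_one]
      · rw [diagonal_apply_ne _ hij]
        have := congrFun (congrFun hz i) j
        rw [mul_diagonal, diagonal_mul] at this
        have h2 : (ZZ e₂ - ZZ e₁) i j * (a i - a j) = 0 := by linear_combination -this
        rcases mul_eq_zero.mp h2 with h3 | h3
        · exact h3
        · exact absurd (ha (sub_eq_zero.mp h3)) hij
    rw [← this]; abel
  have g₃ := psiP_good p lam f e₁ g₁
  have r₃ := psiP_reach p f e₁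
  have heq : psiP p f e₁ = e₂ := by
    have hX : (psiP p f e₁).X = e₂.X := by
      ext1 i
      by_cases hi : i ≤ p
      · have x₁ := xy_yp g₃ i hi
        have x₂ := xy_yp g₂ i hi
        have hY : (psiP p f e₁).Y = e₂.Y := by rw [hY₂, ← hY₁]; rfl
        rw [hY, hZ, ← x₂] at x₁
        have hu : IsUnit (yp e₂.Y (i + 1)) := by
          apply yp_unit (p := p) _ _ (by omega)
          rw [hA₂, isUnit_iff_isUnit_det, det_diagonal, isUnit_iff_ne_zero]
          exact Finset.prod_ne_zero_iff.mpr fun i _ => ha0 i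
        exact hu.mul_right_cancel x₁
      · exact (g₃.2.1 i (by omega)).trans (g₂.2.1 i (by omega)).symm
    have hY : (psiP p f e₁).Y = e₂.Y := by rw [hY₂, ← hY₁]; rfl
    have hv : (psiP p f e₁).v = e₂.v := by rw [hv₂, ← hv₁]; rfl
    have hw : (psiP p f e₁).w = e₂.w := by rw [hw₂, ← hw₁]; rfl
    generalize psiP p f e₁ = x at *
    cases x; cases e₂
    simp only at hX hY hv hw
    subst hX hY hv hw
    rfl
  rw [heq] at r₃
  exact (r₁.trans r₃).trans (reach_symm r₂)

/-! ### Duality for `A` and `B` -/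

theorem BB_dual {n p : ℕ} (d : Dat n) : BB p (dual d) = (AA p d)ᵀ := by
  unfold BB AA
  generalize p + 1 = k
  induction k with
  | zero => simp [ncp, yp]
  | succ k ih => rw [ncp, yp, ih, transpose_mul]; rfl

theorem AA_dual {n p : ℕ} (d : Dat n) : AA p (dual d) = (BB p d)ᵀ := by
  have := BB_dual (p := p) (dual d)
  rw [dual_dual] at this
  rw [this, transpose_transpose]

theorem diag_transpose {n : ℕ} {B Q : Mat n} {b : Fin n → ℂ} (hQ : IsUnit Q)
    (h : B * Q = Q * diagonal b) : ∃ P, IsUnit P ∧ Bᵀ * P = P * diagonal b := by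
  have hd := (isUnit_iff_isUnit_det _).mp hQ
  refine ⟨(Q⁻¹)ᵀ, ?_, ?_⟩
  · rw [Matrix.isUnit_transpose]
    exact Matrix.isUnit_nonsing_inv_iff.mpr hQ
  · have h2 : Q⁻¹ * B = diagonal b * Q⁻¹ := by
      have := congrArg (fun x : Mat n => Q⁻¹ * x * Q⁻¹) h
      rw [← mul_assoc, mul_nonsing_inv_cancel_right _ _ hd, ← mul_assoc, nonsing_inv_mul _ hd,
        one_mul] at this
      exact this
    have := congrArg transpose h2
    rw [transpose_mul, transpose_mul, diagonal_transpose] at this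
    exact this


/-! ### Step 1: total matrices -/

section Total
variable {F : Type*} [Field F] {n p : ℕ}

def emb (j : ZMod (p + 1)) (u : Fin n → F) : ZMod (p + 1) × Fin n → F :=
  fun a => if a.1 = j then u a.2 else 0

def TX (Xs : ZMod (p + 1) → Matrix (Fin n) (Fin n) F) :
    Matrix (ZMod (p + 1) × Fin n) (ZMod (p + 1) × Fin n) F :=
  Matrix.of fun a b => if b.1 = a.1 + 1 then Xs a.1 a.2 b.2 else 0

def TY (Ys : ZMod (p + 1) → Matrix (Fin n) (Fin n) F) :
    Matrix (ZMod (p + 1) × Fin n) (ZMod (p + 1) × Fin n) F :=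
  Matrix.of fun a b => if a.1 = b.1 + 1 then Ys b.1 a.2 b.2 else 0

theorem TX_emb (Xs : ZMod (p + 1) → Matrix (Fin n) (Fin n) F) (j : ZMod (p + 1)) (u : Fin n → F) :
    TX Xs *ᵥ emb j u = emb (j - 1) (Xs (j - 1) *ᵥ u) := by
  ext a
  have e : ∀ z : ZMod (p + 1), (j = z + 1) = (z = j - 1) := fun z => by
    rw [eq_sub_iff_add_eq]; exact propext eq_comm
  simp only [mulVec, dotProduct, TX, emb, Matrix.of_apply, Fintype.sum_prod_type]
  rw [Finset.sum_eq_single j]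
  · simp only [if_true, e]
    split_ifs with h
    · rw [h]
    · simp
  · intro b _ hb
    simp [hb]
  · simp

theorem TY_emb (Ys : ZMod (p + 1) → Matrix (Fin n) (Fin n) F) (j : ZMod (p + 1)) (u : Fin n → F) :
    TY Ys *ᵥ emb j u = emb (j + 1) (Ys j *ᵥ u) := by
  ext a
  simp only [mulVec, dotProduct, TY, emb, Matrix.of_apply, Fintype.sum_prod_type]
  rw [Finset.sum_eq_single j]
  · simp only [if_true]
    split_ifs with h
    · rfl
    · simp
  · intro b _ hb
    simp [hb]
  · simp

theorem emb_TX (Xs : ZMod (p + 1) → Matrix (Fin n) (Fin n) F) (j : ZMod (p + 1)) (u : Fin n → F) :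
    emb j u ᵥ* TX Xs = emb (j + 1) (u ᵥ* Xs j) := by
  ext a
  simp only [vecMul, dotProduct, TX, emb, Matrix.of_apply, Fintype.sum_prod_type]
  rw [Finset.sum_eq_single j]
  · simp only [if_true]
    split_ifs with h
    · rfl
    · simp
  · intro b _ hb
    simp [hb]
  · simp

theorem emb_TY (Ys : ZMod (p + 1) → Matrix (Fin n) (Fin n) F) (j : ZMod (p + 1)) (u : Fin n → F) :
    emb j u ᵥ* TY Ys = emb (j - 1) (u ᵥ* Ys (j - 1)) := by
  ext a
  have e : ∀ z : ZMod (p + 1), (j = z + 1) = (z = j - 1) := fun z => by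
    rw [eq_sub_iff_add_eq]; exact propext eq_comm
  simp only [vecMul, dotProduct, TY, emb, Matrix.of_apply, Fintype.sum_prod_type]
  rw [Finset.sum_eq_single j]
  · simp only [if_true, e]
    split_ifs with h
    · rw [h]
    · simp
  · intro b _ hb
    simp [hb]
  · simp

theorem emb_dot (i j : ZMod (p + 1)) (u u' : Fin n → F) :
    emb i u' ⬝ᵥ emb j u = if i = j then u' ⬝ᵥ u else 0 := by
  simp only [dotProduct, emb, Fintype.sum_prod_type]
  rw [Finset.sum_eq_single j]
  · simp only [if_true, eq_comm]
    split_ifs with h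
    · rfl
    · simp
  · intro b _ hb
    simp [hb]
  · simp

theorem emb_ne (j : ZMod (p + 1)) (u : Fin n → F) (hu : u ≠ 0) : emb j u ≠ 0 := by
  intro h
  apply hu
  ext i
  simpa [emb] using congrFun h (j, i)

theorem emb_zero (j : ZMod (p + 1)) : emb j (0 : Fin n → F) = 0 := by
  ext a; simp [emb]

theorem emb_smul (j : ZMod (p + 1)) (c : F) (u : Fin n → F) : emb j (c • u) = c • emb j u := by
  ext a; simp [emb]

theorem emb_add (j : ZMod (p + 1)) (u u' : Fin n → F) : emb j (u + u') = emb j u + emb j u' := by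
  ext a; simp only [emb, Pi.add_apply]; split_ifs <;> simp

theorem emb_sub (j : ZMod (p + 1)) (u u' : Fin n → F) : emb j (u - u') = emb j u - emb j u' := by
  ext a; simp only [emb, Pi.sub_apply]; split_ifs <;> simp

theorem emb_ext (M N : Matrix (ZMod (p + 1) × Fin n) (ZMod (p + 1) × Fin n) F)
    (h : ∀ j u, M *ᵥ emb j u = N *ᵥ emb j u) : M = N := by
  ext a b
  have := congrFun (h b.1 (Pi.single b.2 1)) a
  have e : emb b.1 (Pi.single b.2 (1 : F)) = Pi.single b 1 := by
    ext c
    obtain ⟨c1, c2⟩ := c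
    obtain ⟨b1, b2⟩ := b
    simp only [emb, Pi.single_apply, Prod.mk.injEq]
    split_ifs <;> simp_all
  rw [e] at this
  simpa using this

def Lam (l : ZMod (p + 1) → F) : Matrix (ZMod (p + 1) × Fin n) (ZMod (p + 1) × Fin n) F :=
  diagonal fun a => l a.1

theorem Lam_emb (l : ZMod (p + 1) → F) (j : ZMod (p + 1)) (u : Fin n → F) :
    Lam l *ᵥ emb j u = l j • emb j u := by
  ext a
  simp only [Lam, mulVec_diagonal, emb, Pi.smul_apply, smul_eq_mul]
  split_ifs with h
  · rw [h]
  · simp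

theorem emb_Lam (l : ZMod (p + 1) → F) (j : ZMod (p + 1)) (u : Fin n → F) :
    emb j u ᵥ* Lam l = l j • emb j u := by
  ext a
  simp only [Lam, vecMul_diagonal, emb, Pi.smul_apply, smul_eq_mul]
  split_ifs with h
  · rw [h, mul_comm]
  · simp

def ysr (Y : ℕ → Matrix (Fin n) (Fin n) F) (i : ℕ) : ℕ → Matrix (Fin n) (Fin n) F
  | 0 => 1
  | k + 1 => Y (i + k) * ysr Y i k

theorem TY_pow (Ys : ZMod (p + 1) → Matrix (Fin n) (Fin n) F) (j k : ℕ) (u : Fin n → F) :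
    TY Ys ^ k *ᵥ emb (j : ZMod (p + 1)) u =
      emb ((j + k : ℕ) : ZMod (p + 1)) (ysr (fun N => Ys (N : ZMod (p + 1))) j k *ᵥ u) := by
  induction k with
  | zero => simp [ysr]
  | succ k ih =>
    rw [pow_succ', ← mulVec_mulVec, ih, TY_emb, ysr, mulVec_mulVec, ← add_assoc, Nat.cast_succ]

theorem emb_TY_pow (Ys : ZMod (p + 1) → Matrix (Fin n) (Fin n) F) (j : ZMod (p + 1)) (k : ℕ)
    (u : Fin n → F) : ∃ u', emb j u ᵥ* TY Ys ^ k = emb (j - (k : ZMod (p + 1))) u' := by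
  induction k with
  | zero => exact ⟨u, by simp⟩
  | succ k ih =>
    obtain ⟨u', h⟩ := ih
    refine ⟨u' ᵥ* Ys (j - k - 1), ?_⟩
    rw [pow_succ, ← vecMul_vecMul, h, emb_TY, sub_sub, Nat.cast_succ]

theorem tot_false (Xs Ys : ZMod (p + 1) → Matrix (Fin n) (Fin n) F) (v w : Fin n → F)
    (l : ZMod (p + 1) → F)
    (hrel : ∀ j, Xs j * Ys j - Ys (j - 1) * Xs (j - 1) + (if j = 0 then vecMulVec v w else 0) =
      l j • 1)
    (hs : ∀ (j : ZMod (p + 1)) (b : ℕ), ∑ d ∈ Finset.range (b + 1), l (j + d) ≠ 0)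
    (i : ℕ) (u u' : Fin n → F) (hu : u ≠ 0) (hu' : u' ≠ 0) (hXu : Xs i *ᵥ u = 0)
    (hXu' : u' ᵥ* Xs i = 0)
    (hY : ∀ k, u' ⬝ᵥ (ysr (fun N => Ys (N : ZMod (p + 1))) (i + 1) (p + (p + 1) * k) *ᵥ u) = 0) :
    False := by
  refine core (TX Xs) (TY Ys) (Lam l) (emb 0 v) (emb 0 w) (emb ((i + 1 : ℕ) : ZMod (p + 1)) u)
    (emb (i : ZMod (p + 1)) u') (fun d => l ((i + 1 : ℕ) + d)) (fun c => l (i - c))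
    ?_ ?_ ?_ ?_ ?_ ?_ ?_ ?_ (emb_ne _ _ hu) (emb_ne _ _ hu')
  · apply emb_ext
    intro j x
    have h := congrArg (fun M => emb j (M *ᵥ x)) (hrel j)
    simp only [add_mulVec, sub_mulVec, smul_mulVec, one_mulVec, emb_add, emb_sub, emb_smul] at h
    rw [Lam_emb, ← h, add_mulVec, sub_mulVec, ← mulVec_mulVec, ← mulVec_mulVec, TY_emb, TX_emb,
      TX_emb, TY_emb, add_sub_cancel_right, sub_add_cancel, mulVec_mulVec, mulVec_mulVec]
    congr 1
    rw [vecMulVec_mulVec, emb_dot]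
    by_cases hj : j = 0
    · subst hj
      rw [if_pos rfl, if_pos rfl, vecMulVec_mulVec]
      ext a; simp only [emb, Pi.smul_apply]; split_ifs <;> simp
    · rw [if_neg hj, if_neg (Ne.symm hj)]
      simp [emb_zero]
  · intro d
    rw [TY_pow, Lam_emb, Nat.cast_add (i + 1) d]
  · intro c
    obtain ⟨x, hx⟩ := emb_TY_pow Ys (i : ZMod (p + 1)) c u'
    rw [hx, emb_Lam]
  · rw [TX_emb]
    have : ((i + 1 : ℕ) : ZMod (p + 1)) - 1 = i := by push_cast; ring
    rw [this, hXu, emb_zero]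
  · rw [emb_TX, hXu', emb_zero]
  · intro k
    rw [TY_pow, emb_dot]
    split_ifs with h
    · have h2 : ((k + 1 : ℕ) : ZMod (p + 1)) = 0 := by
        push_cast at h ⊢
        linear_combination -h
      rw [ZMod.natCast_eq_zero_iff] at h2
      obtain ⟨c, hc⟩ := h2
      cases c with
      | zero => omega
      | succ c =>
        have : k = p + (p + 1) * c := by
          have : (p + 1) * (c + 1) = (p + 1) * c + p + 1 := by ring
          omega
        rw [this]; exact hY c
    · rfl
  · intro b; exact hs _ b
  · intro b
    have := hs (i - b) b
    rw [← Finset.sum_range_reflect] at this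
    convert this using 1
    apply Finset.sum_congr rfl
    intro d hd
    congr 1
    have hd := Finset.mem_range.mp hd
    have e : b + 1 - 1 - d = b - d := by omega
    rw [e, Nat.cast_sub (by omega)]
    ring

end Total

/-! ### Consequence of genericity -/

theorem Sper (p : ℕ) (lam : ℕ → ℂ) (q r : ℕ) :
    ∑ t ∈ Finset.range ((p + 1) * q + r), lam (t % (p + 1)) =
      q * ∑ t ∈ Finset.range (p + 1), lam t + ∑ t ∈ Finset.range r, lam (t % (p + 1)) := by
  induction q with
  | zero => simp
  | succ q ih =>
    have e : (p + 1) * (q + 1) + r = (p + 1) + ((p + 1) * q + r) := by ring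
    rw [e, Finset.sum_range_add]
    have h1 : ∑ t ∈ Finset.range (p + 1), lam (t % (p + 1)) = ∑ t ∈ Finset.range (p + 1), lam t :=
      Finset.sum_congr rfl fun t ht => by rw [Nat.mod_eq_of_lt (Finset.mem_range.mp ht)]
    simp only [Nat.add_mod_left]
    rw [ih, h1]
    push_cast; ring

theorem arc_ne {p : ℕ} {lam : ℕ → ℂ} (hg : Generic p lam) (a b : ℕ) (hab : a < b) :
    ∑ t ∈ Finset.range b, lam (t % (p + 1)) - ∑ t ∈ Finset.range a, lam (t % (p + 1)) ≠ 0 := by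
  obtain ⟨hκ, hg⟩ := hg
  have hS : ∀ r, r ≤ p + 1 → ∑ t ∈ Finset.range r, lam (t % (p + 1)) =
      ∑ t ∈ Finset.range r, lam t := fun r hr =>
    Finset.sum_congr rfl fun t ht => by
      rw [Nat.mod_eq_of_lt (by have := Finset.mem_range.mp ht; omega)]
  have key : ∀ r s : ℕ, r < s → s ≤ p → ∀ k : ℤ,
      ∑ t ∈ Finset.range s, lam t - ∑ t ∈ Finset.range r, lam t +
        (k : ℂ) * ∑ t ∈ Finset.range (p + 1), lam t ≠ 0 := by
    intro r s hrs hsp k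
    by_cases hr : r = 0
    · subst hr
      have h1 := hg s p (by omega) hsp le_rfl (-k - 1)
      have e : ∑ t ∈ Finset.Icc s p, lam t =
          ∑ t ∈ Finset.range (p + 1), lam t - ∑ t ∈ Finset.range s, lam t := by
        rw [← Finset.sum_Ico_eq_sub _ (by omega)]; rfl
      intro h
      apply h1
      rw [e]
      push_cast
      simp only [Finset.range_zero, Finset.sum_empty] at h
      linear_combination -h
    · have h1 := hg r (s - 1) (by omega) (by omega) (by omega) k
      have e : ∑ t ∈ Finset.Icc r (s - 1), lam t =
          ∑ t ∈ Finset.range s, lam t - ∑ t ∈ Finset.range r, lam t := by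
        rw [← Finset.sum_Ico_eq_sub _ (by omega)]
        apply Finset.sum_congr _ fun _ _ => rfl
        ext t; simp only [Finset.mem_Icc, Finset.mem_Ico]; omega
      rw [e] at h1
      exact h1
  have ha := Nat.div_add_mod a (p + 1)
  have hb := Nat.div_add_mod b (p + 1)
  have ha' := Nat.mod_lt a (show 0 < p + 1 by omega)
  have hb' := Nat.mod_lt b (show 0 < p + 1 by omega)
  generalize a / (p + 1) = q at *
  generalize b / (p + 1) = q' at *
  generalize a % (p + 1) = r at *
  generalize b % (p + 1) = r' at *
  rw [← ha, ← hb, Sper, Sper, hS r (by omega), hS r' (by omega)]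
  intro h
  rcases lt_trichotomy r r' with hr | hr | hr
  · apply key r r' hr (by omega) ((q' : ℤ) - q)
    push_cast
    linear_combination h
  · subst hr
    have h2 : ((q' : ℂ) - q) * ∑ t ∈ Finset.range (p + 1), lam t = 0 := by linear_combination h
    rcases mul_eq_zero.mp h2 with h3 | h3
    · have h4 : (q' : ℂ) = q := sub_eq_zero.mp h3
      have h5 : q' = q := by exact_mod_cast h4
      subst h5
      omega
    · exact hκ h3
  · apply key r' r hr (by omega) ((q : ℤ) - q')
    push_cast
    linear_combination -h

theorem arc_zmod {p : ℕ} {lam : ℕ → ℂ} (hg : Generic p lam) (j : ZMod (p + 1)) (b : ℕ) :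
    ∑ d ∈ Finset.range (b + 1), lam (j + d : ZMod (p + 1)).val ≠ 0 := by
  have h := arc_ne hg j.val (j.val + (b + 1)) (by omega)
  rw [Finset.sum_range_add, add_sub_cancel_left] at h
  convert h using 1
  apply Finset.sum_congr rfl
  intro d _
  rw [← ZMod.val_natCast]
  congr 2
  rw [Nat.cast_add, ZMod.natCast_zmod_val]


/-! ### Step 1 -/

theorem rel_zmod {n p : ℕ} {lam : ℕ → ℂ} {d : Dat n} (h : Good p lam d) (j : ZMod (p + 1)) :
    (d.X j.val : Mat n) * (d.Y j.val : Mat n) -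
      (d.Y (j - 1).val : Mat n) * (d.X (j - 1).val : Mat n) +
      (if j = 0 then vecMulVec d.v d.w else 0) = lam j.val • (1 : Mat n) := by
  obtain ⟨N, hN, rfl⟩ : ∃ N : ℕ, N < p + 1 ∧ j = (N : ZMod (p + 1)) :=
    ⟨j.val, ZMod.val_lt j, (ZMod.natCast_zmod_val j).symm⟩
  cases N with
  | zero =>
    have e : ((0 : ℕ) : ZMod (p + 1)) - 1 = ((p : ℕ) : ZMod (p + 1)) := by
      have := ZMod.natCast_self (p + 1)
      push_cast at this ⊢
      linear_combination -this
    rw [e, ZMod.val_natCast, ZMod.val_natCast, Nat.mod_eq_of_lt hN, Nat.mod_eq_of_lt (by omega),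
      if_pos (by simp)]
    exact h.1.1
  | succ k =>
    have e : ((k + 1 : ℕ) : ZMod (p + 1)) - 1 = ((k : ℕ) : ZMod (p + 1)) := by
      push_cast; ring
    rw [e, ZMod.val_natCast, ZMod.val_natCast, Nat.mod_eq_of_lt hN, Nat.mod_eq_of_lt (by omega),
      if_neg, add_zero]
    · exact h.1.2 k (by omega)
    · intro h0
      have := congrArg ZMod.val h0
      rw [ZMod.val_natCast, Nat.mod_eq_of_lt hN, ZMod.val_zero] at this
      omega

theorem ysr_map {F : Type*} [Field F] {n : ℕ} (f : ℂ →+* F) (Y : ℕ → Mat n) (i k : ℕ) :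
    ysr (fun N => (Y N).map f) i k = (ys Y i k).map f := by
  induction k with
  | zero => simp [ysr, ys]
  | succ k ih => rw [ysr, ys, ih, Matrix.map_mul]

theorem ys_congr {n : ℕ} (Y Y' : ℕ → Mat n) (i i' k : ℕ) (h : ∀ t < k, Y (i + t) = Y' (i' + t)) :
    ys Y i k = ys Y' i' k := by
  induction k with
  | zero => rfl
  | succ k ih => rw [ys, ys, ih fun t ht => h t (by omega), h k (by omega)]

theorem ys_add {n : ℕ} (Y : ℕ → Mat n) (i a b : ℕ) :
    ys Y i (a + b) = ys Y (i + a) b * ys Y i a := by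
  induction b with
  | zero => simp [ys]
  | succ b ih => rw [← add_assoc, ys, ys, ih, mul_assoc, add_assoc]

theorem ys_zero {n : ℕ} (Y : ℕ → Mat n) (k : ℕ) : ys Y 0 k = yp Y k := by
  have := ys_yp Y 0 k
  simpa [yp] using this

theorem ys_per_pow {n : ℕ} (p : ℕ) (Y : ℕ → Mat n) (k : ℕ) :
    ys (fun N => Y (N % (p + 1))) (p + 1) ((p + 1) * k) = yp Y (p + 1) ^ k := by
  induction k with
  | zero => simp [ys]
  | succ k ih =>
    rw [mul_add, mul_one, ys_add, ih, pow_succ', ← ys_zero]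
    congr 1
    apply ys_congr
    intro t ht
    have : p + 1 + (p + 1) * k + t = t + (p + 1) * (k + 1) := by ring
    rw [this, Nat.add_mul_mod_self_left, Nat.mod_eq_of_lt ht, zero_add]

theorem ys_per {n : ℕ} (p : ℕ) (Y : ℕ → Mat n) (i k : ℕ) (hi : i ≤ p) :
    ys (fun N => Y (N % (p + 1))) (i + 1) (p + (p + 1) * k) =
      yp Y i * yp Y (p + 1) ^ k * yc p Y i := by
  have e : p + (p + 1) * k = (p - i) + ((p + 1) * k + i) := by omega
  have e2 : i + 1 + (p - i) = p + 1 := by omega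
  rw [e, ys_add, e2, ys_add, ys_per_pow, yc, if_pos hi, ← ys_zero Y i]
  congr 1
  · congr 1
    apply ys_congr
    intro t ht
    have : p + 1 + (p + 1) * k + t = t + (p + 1) * (k + 1) := by ring
    rw [this, Nat.add_mul_mod_self_left, Nat.mod_eq_of_lt (by omega), zero_add]
  · apply ys_congr
    intro t ht
    rw [Nat.mod_eq_of_lt (by omega)]

def NN {n : ℕ} (p : ℕ) (d : Dat n) (i : ℕ) (k : Fin n) : Mat n :=
  yp d.Y i * AA p d ^ (k : ℕ) * yc p d.Y i

def XP {n : ℕ} (p : ℕ) (d : Dat n) (i : ℕ) : Matrix (Fin n) (Fin n) (PR n) :=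
  lin (d.X i : Mat n) (NN p d i)

def fT {n : ℕ} (t : Fin n → ℂ) : Polynomial ℂ := ∑ k : Fin n, Polynomial.monomial (k : ℕ) (t k)

theorem XP_eval {n : ℕ} (p : ℕ) (d : Dat n) (i : ℕ) (t : Fin n → ℂ) :
    (XP p d i).map (MvPolynomial.eval t) = ((psiP p (fT t) d).X i : Mat n) := by
  rw [XP, lin_eval]
  change _ = (d.X i : Mat n) + yp d.Y i * Polynomial.aeval (yp d.Y (p + 1)) (fT t) * yc p d.Y i
  congr 1
  rw [fT, map_sum, Finset.mul_sum, Finset.sum_mul]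
  apply Finset.sum_congr rfl
  intro k _
  rw [Polynomial.aeval_monomial, ← Algebra.smul_def, mul_smul_comm, smul_mul_assoc]
  rfl

theorem lift_zero {n M : ℕ} (N : Matrix (Fin n) (Fin n) (PR M))
    (h : ∀ t, N.map (MvPolynomial.eval t) = 0) : N = 0 := by
  ext1 i j
  apply MvPolynomial.funext
  intro t
  have := congrFun (congrFun (h t) i) j
  simpa using this

theorem relPR {n p : ℕ} {lam : ℕ → ℂ} {d : Dat n} (h : Good p lam d) (j : ZMod (p + 1)) :
    XP p d j.val * (d.Y j.val : Mat n).map (MvPolynomial.C : ℂ →+* PR n) -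
      (d.Y (j - 1).val : Mat n).map (MvPolynomial.C : ℂ →+* PR n) * XP p d (j - 1).val +
      (if j = 0 then (vecMulVec d.v d.w : Mat n) else 0).map (MvPolynomial.C : ℂ →+* PR n) -
      (lam j.val • (1 : Mat n)).map (MvPolynomial.C : ℂ →+* PR n) = 0 := by
  apply lift_zero
  intro t
  have h1 := rel_zmod (psiP_good p lam (fT t) d h) j
  have e : ∀ M : Mat n, (M.map (MvPolynomial.C : ℂ →+* PR n)).map (MvPolynomial.eval t) = M := by
    intro M; ext a b; simp
  rw [Matrix.map_sub _ (by simp), Matrix.map_add _ (by simp), Matrix.map_sub _ (by simp),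
    Matrix.map_mul, Matrix.map_mul, e, e, e, e, XP_eval, XP_eval, sub_eq_zero]
  exact h1

theorem relGF {n p : ℕ} {lam : ℕ → ℂ} {d : Dat n} (h : Good p lam d) (j : ZMod (p + 1)) :
    (XP p d j.val).map (algebraMap (PR n) (GF n)) * (d.Y j.val : Mat n).map (algebraMap ℂ (GF n)) -
      (d.Y (j - 1).val : Mat n).map (algebraMap ℂ (GF n)) *
        (XP p d (j - 1).val).map (algebraMap (PR n) (GF n)) +
      (if j = 0 then vecMulVec (fun a => algebraMap ℂ (GF n) (d.v a))
        (fun a => algebraMap ℂ (GF n) (d.w a)) else 0) =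
      algebraMap ℂ (GF n) (lam j.val) • (1 : Matrix (Fin n) (Fin n) (GF n)) := by
  have h1 := congrArg (fun M => M.map (algebraMap (PR n) (GF n))) (relPR h j)
  have e : ∀ M : Mat n, (M.map (MvPolynomial.C : ℂ →+* PR n)).map (algebraMap (PR n) (GF n)) =
      M.map (algebraMap ℂ (GF n)) := by
    intro M; ext a b
    simp only [Matrix.map_apply]
    rw [IsScalarTower.algebraMap_apply ℂ (PR n) (GF n)]; rfl
  rw [Matrix.map_sub _ (by simp), Matrix.map_add _ (by simp), Matrix.map_sub _ (by simp),
    Matrix.map_mul, Matrix.map_mul, e, e, e, e, Matrix.map_zero _ (by simp), sub_eq_zero] at h1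
  have e2 : (lam j.val • (1 : Mat n)).map (algebraMap ℂ (GF n)) =
      algebraMap ℂ (GF n) (lam j.val) • (1 : Matrix (Fin n) (Fin n) (GF n)) := by
    ext a b
    simp only [Matrix.map_apply, Matrix.smul_apply, Matrix.one_apply, smul_eq_mul]
    split_ifs <;> simp
  rw [← e2, ← h1]
  congr 1
  split_ifs
  · ext a b; simp [vecMulVec_apply]
  · simp

theorem XP_det {n p : ℕ} {lam : ℕ → ℂ} (hg : Generic p lam) {d : Dat n} (h : Good p lam d)
    (i : ℕ) (hi : i ≤ p) : (XP p d i).det ≠ 0 := by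
  intro hdet
  set XG : Matrix (Fin n) (Fin n) (GF n) := (XP p d i).map (algebraMap (PR n) (GF n)) with hXG
  have hdG : XG.det = 0 := by
    have : XG = (algebraMap (PR n) (GF n)).mapMatrix (XP p d i) := rfl
    rw [this, ← RingHom.map_det, hdet, map_zero]
  obtain ⟨u, hu, hXu⟩ := Matrix.exists_mulVec_eq_zero_iff.mpr hdG
  obtain ⟨u', hu', hXu'⟩ := Matrix.exists_vecMul_eq_zero_iff.mpr hdG
  let L : Matrix (Fin n) (Fin n) (GF n) →ₗ[GF n] GF n :=
    { toFun := fun M => u' ⬝ᵥ (((yp d.Y i).map (algebraMap ℂ (GF n)) * M *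
        (yc p d.Y i).map (algebraMap ℂ (GF n))) *ᵥ u)
      map_add' := fun M N => by rw [mul_add, add_mul, add_mulVec, dotProduct_add]
      map_smul' := fun c M => by
        rw [mul_smul_comm, smul_mul_assoc, smul_mulVec, dotProduct_smul]; rfl }
  have hLk : ∀ k, L ((AA p d).map (algebraMap ℂ (GF n)) ^ k) =
      u' ⬝ᵥ ((yp d.Y i * AA p d ^ k * yc p d.Y i).map (algebraMap ℂ (GF n)) *ᵥ u) := by
    intro k
    change u' ⬝ᵥ _ = _
    have : (AA p d).map (algebraMap ℂ (GF n)) ^ k = (AA p d ^ k).map (algebraMap ℂ (GF n)) :=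
      (map_pow (algebraMap ℂ (GF n)).mapMatrix (AA p d) k).symm
    rw [this, Matrix.map_mul, Matrix.map_mul]
  have hL : ∀ k, L ((AA p d).map (algebraMap ℂ (GF n)) ^ k) = 0 := by
    apply pow_functional n (by simp)
    intro k hk
    rw [hLk]
    obtain ⟨D, hD⟩ := gf_deriv n ⟨k, hk⟩
    have h1 := deriv_pair D XG u u' hXu hXu'
    rw [hXG, XP, lin_deriv _ _ _ D hD] at h1
    exact h1
  have hval : ((i : ℕ) : ZMod (p + 1)).val = i := by
    rw [ZMod.val_natCast, Nat.mod_eq_of_lt (by omega)]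
  refine tot_false (p := p) (fun z => (XP p d z.val).map (algebraMap (PR n) (GF n)))
    (fun z => (d.Y z.val : Mat n).map (algebraMap ℂ (GF n)))
    (fun a => algebraMap ℂ (GF n) (d.v a)) (fun a => algebraMap ℂ (GF n) (d.w a))
    (fun z => algebraMap ℂ (GF n) (lam z.val)) (relGF h) ?_ i u u' hu hu' ?_ ?_ ?_
  · intro j b
    rw [← map_sum]
    exact (map_ne_zero _).mpr (arc_zmod hg j b)
  · rw [hval]; exact hXu
  · rw [hval]; exact hXu'
  · intro k
    have e : (fun N : ℕ => (d.Y (N : ZMod (p + 1)).val : Mat n).map (algebraMap ℂ (GF n))) =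
        fun N => (d.Y (N % (p + 1)) : Mat n).map (algebraMap ℂ (GF n)) := by
      ext1 N; rw [ZMod.val_natCast]
    rw [e, ysr_map (algebraMap ℂ (GF n)) (fun N => (d.Y (N % (p + 1)) : Mat n)), ys_per p d.Y i k hi]
    exact (hLk k).symm.trans (hL k)

theorem step1 {n p : ℕ} {lam : ℕ → ℂ} (hg : Generic p lam) {d : Dat n} (h : Good p lam d) :
    ∃ d', Reach p n d d' ∧ Good p lam d' ∧ IsUnit (BB p d') := by
  have hne : ∏ i ∈ Finset.range (p + 1), (XP p d i).det ≠ 0 :=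
    Finset.prod_ne_zero_iff.mpr fun i hi => XP_det hg h i (by have := Finset.mem_range.mp hi; omega)
  obtain ⟨t, ht⟩ := exists_eval_ne _ hne
  rw [map_prod] at ht
  refine ⟨psiP p (fT t) d, psiP_reach p _ d, psiP_good p lam _ d h, ?_⟩
  have hu : ∀ i, i ≤ p → IsUnit ((psiP p (fT t) d).X i : Mat n) := by
    intro i hi
    rw [← XP_eval, isUnit_iff_isUnit_det, isUnit_iff_ne_zero]
    have h1 := Finset.prod_ne_zero_iff.mp ht i (Finset.mem_range.mpr (by omega))
    rw [RingHom.map_det] at h1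
    exact h1
  have : ∀ k, k ≤ p + 1 → IsUnit (ncp (M := Mat n) (psiP p (fT t) d).X k) := by
    intro k
    induction k with
    | zero => intro _; exact isUnit_one
    | succ k ih => intro hk; exact (ih (by omega)).mul (hu k (by omega))
  exact this _ le_rfl

/-! ### Conclusion -/

theorem reachReg {n p : ℕ} {lam : ℕ → ℂ} (hg : Generic p lam) {d : Dat n} (h : Good p lam d) :
    ∃ d', Reach p n d d' ∧ Good p lam d' ∧ ∃ P a, IsUnit P ∧ Function.Injective a ∧
      (∀ i, a i ≠ 0) ∧ AA p d' * P = P * diagonal a := by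
  obtain ⟨e, r, ge, hB⟩ := step1 hg h
  have hA : IsUnit (AA p (dual e)) := by
    rw [AA_dual, Matrix.isUnit_transpose]; exact hB
  obtain ⟨f, rf, gf, P, b, hP, hb, hb0, hBf⟩ := step2 hg.1 (good_dual ge) hA
  obtain ⟨Q, hQ, hQf⟩ := diag_transpose hP hBf
  refine ⟨dual f, r.trans ?_, good_dual gf, Q, b, hQ, hb, hb0, ?_⟩
  · have := reach_dual rf
    rwa [dual_dual] at this
  · rw [AA_dual]; exact hQf

theorem transitive {n p : ℕ} {lam : ℕ → ℂ} (hg : Generic p lam) {d₁ d₂ : Dat n}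
    (h₁ : Good p lam d₁) (h₂ : Good p lam d₂) : Reach p n d₁ d₂ := by
  obtain ⟨e₁, r₁, g₁, P₁, a₁, hP₁, ha₁, hz₁, hA₁⟩ := reachReg hg h₁
  obtain ⟨e₂, r₂, g₂, P₂, a₂, hP₂, ha₂, hz₂, hA₂⟩ := reachReg hg h₂
  let b : Fin n → ℂ := fun i => ((i : ℕ) : ℂ) + 1
  have hb : Function.Injective b := by
    intro i j hij
    have h1 : ((i : ℕ) : ℂ) = ((j : ℕ) : ℂ) := add_right_cancel hij
    exact Fin.ext (by exact_mod_cast h1)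
  have hb0 : ∀ i, b i ≠ 0 := fun i => Nat.cast_add_one_ne_zero _
  have s₁ := step3 g₁ P₁ hP₁ a₁ b hA₁ ha₁ hz₁ hb0 hb
  have s₂ := step3 g₂ P₂ hP₂ a₂ b hA₂ ha₂ hz₂ hb0 hb
  obtain ⟨e, ⟨⟨f₁, t₁, k₁, Q₁, hQ₁, hB₁⟩, ⟨f₂, t₂, k₂, Q₂, hQ₂, hB₂⟩⟩, he⟩ :=
    ((s₁.and s₂).and self_mem_nhdsWithin).exists
  have he0 : e⁻¹ ^ (p + 1) ≠ 0 := pow_ne_zero _ (inv_ne_zero he)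
  obtain ⟨R₁, hR₁, hD₁⟩ := diag_transpose hQ₁ hB₁
  obtain ⟨R₂, hR₂, hD₂⟩ := diag_transpose hQ₂ hB₂
  rw [← AA_dual] at hD₁ hD₂
  have key := step4 hg.1 (good_dual k₁) (good_dual k₂) R₁ R₂ hR₁ hR₂ _ hD₁ hD₂
    (fun i => mul_ne_zero he0 (hb0 i))
    (fun i j hij => hb (mul_left_cancel₀ he0 hij))
  have key := reach_dual key
  rw [dual_dual, dual_dual] at key
  exact ((r₁.trans t₁).trans key).trans (reach_symm (r₂.trans t₂))

/-- For `m = p + 1 ≥ 1`, `n ≥ 1` and generic `λ`, the group generated by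
all `Ψ_{k,μ}`, all `Φ_{k,ν}` (`k ≥ 1`) and all base changes acts transitively on the set of
representation data of constant dimension vector `(n, …, n)` (whose GL-orbits form the
generalized `n`-th Calogero–Moser space): any two such tuples satisfying (qv1)–(qv2) are
joined by a finite composition of these transformations. -/
theorem statement1 (p n : ℕ) (hn : 1 ≤ n) (lam : ℕ → ℂ)
    (hgen : Generic p lam) (d₁ d₂ : Datum (fun _ : ℕ => n))
    (h₁ : IsRepDatum (α := fun _ : ℕ => n) p lam rfl d₁) (h₂ : IsRepDatum (α := fun _ : ℕ => n) p lam rfl d₂)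
    (hX₁ : ∀ i : ℕ, p < i → d₁.X i = 0) (hY₁ : ∀ i : ℕ, p < i → d₁.Y i = 0)
    (hX₂ : ∀ i : ℕ, p < i → d₂.X i = 0) (hY₂ : ∀ i : ℕ, p < i → d₂.Y i = 0) :
    Relation.ReflTransGen (Step p (rfl : (fun _ : ℕ => n) (p + 1) = (fun _ : ℕ => n) 0)) d₁ d₂ := by
  exact transitive hgen ⟨rel_of p lam d₁ h₁, hX₁, hY₁⟩ ⟨rel_of p lam d₂ h₂, hX₂, hY₂⟩

end
end CM
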